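/- Let κ satisfy the energy, consistency, and domination principles, and assume (A1) and (A2). Then for every set A ⊂ X there exists a σ-compact (K_σ) set A₀ ⊂ A, independent of μ, such that: (i) for every set Q with A₀ ⊂ Q ⊂ A and every μ ∈ E⁺, μ^A = μ^Q = μ^{A₀}; and (ii) for every Borel set B with A₀ ⊂ B ⊂ A and every μ ∈ E⁺, the outer balayages μ^{*B} and μ^{*A₀} exist and μ^A = μ^{*B} = μ^{*A₀}. -/

import Mathlib

open MeasureTheory Filter Topology Set
open scoped ENNReal NNReal

namespace Balayage

variable {X : Type*} [TopologicalSpace X] [T2Space X] [LocallyCompactSpace X]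
  [MeasurableSpace X] [BorelSpace X]

/-- The potential `κμ(x) := ∫ κ(x,y) dμ(y)`. -/
noncomputable def pot (κ : X → X → ℝ≥0∞) (μ : Measure X) (x : X) : ℝ≥0∞ :=
  ∫⁻ y, κ x y ∂μ

/-- The mutual energy `κ(μ,ν) := ∬ κ(x,y) d(μ⊗ν)(x,y)`. -/
noncomputable def energy (κ : X → X → ℝ≥0∞) (μ ν : Measure X) : ℝ≥0∞ :=
  ∫⁻ x, pot κ ν x ∂μ

/-- A positive Radon measure: locally finite and inner regular. -/
def IsRadon (μ : Measure X) : Prop :=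
  μ.InnerRegular ∧ IsLocallyFiniteMeasure μ

/-- `E⁺`: the positive Radon measures of finite energy. -/
def Eplus (κ : X → X → ℝ≥0∞) : Set (Measure X) :=
  {μ | IsRadon μ ∧ energy κ μ μ < ⊤}

/-- `μ` is concentrated on `A`: `A` is `μ`-measurable and `X∖A` is locally `μ`-negligible. -/
def ConcOn (μ : Measure X) (A : Set X) : Prop :=
  NullMeasurableSet A μ ∧ ∀ K : Set X, IsCompact K → μ (Aᶜ ∩ K) = 0

/-- `E⁺_A`: measures of finite energy concentrated on `A`. -/
def EplusOn (κ : X → X → ℝ≥0∞) (A : Set X) : Set (Measure X) :=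
  {μ ∈ Eplus κ | ConcOn μ A}

/-- The inner capacity `c_*(A)`. -/
noncomputable def innerCap (κ : X → X → ℝ≥0∞) (A : Set X) : ℝ≥0∞ :=
  (⨅ μ ∈ {μ ∈ EplusOn κ A | μ Set.univ = 1}, energy κ μ μ)⁻¹

/-- `P` holds nearly everywhere on `A`: the set where it fails has inner capacity zero. -/
def NEOn (κ : X → X → ℝ≥0∞) (A : Set X) (P : X → Prop) : Prop :=
  innerCap κ {x | x ∈ A ∧ ¬ P x} = 0

/-- The outer capacity `c^*(A)`. -/
noncomputable def outerCap (κ : X → X → ℝ≥0∞) (A : Set X) : ℝ≥0∞ :=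
  ⨅ D ∈ {D : Set X | IsOpen D ∧ A ⊆ D}, innerCap κ D

/-- `P` holds quasi-everywhere on `A`: the set where it fails has outer capacity zero. -/
def QEOn (κ : X → X → ℝ≥0∞) (A : Set X) (P : X → Prop) : Prop :=
  outerCap κ {x | x ∈ A ∧ ¬ P x} = 0

/-- The class `Λ_{A,μ}` of measures `ν ∈ E⁺` with `κν ≥ κμ` n.e. on `A`. -/
def InnerLam (κ : X → X → ℝ≥0∞) (A : Set X) (μ : Measure X) : Set (Measure X) :=
  {ν ∈ Eplus κ | NEOn κ A (fun x => pot κ μ x ≤ pot κ ν x)}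

/-- The class `Λ*_{A,μ}` of measures `ν ∈ E⁺` with `κν ≥ κμ` q.e. on `A`. -/
def OuterLam (κ : X → X → ℝ≥0∞) (A : Set X) (μ : Measure X) : Set (Measure X) :=
  {ν ∈ Eplus κ | QEOn κ A (fun x => pot κ μ x ≤ pot κ ν x)}

/-- `b` is the inner balayage `μ^A`: the measure of minimal potential in `Λ_{A,μ}`. -/
def IsInnerBal (κ : X → X → ℝ≥0∞) (A : Set X) (μ b : Measure X) : Prop :=
  b ∈ InnerLam κ A μ ∧ ∀ ν ∈ InnerLam κ A μ, ∀ x, pot κ b x ≤ pot κ ν x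

/-- `b` is the outer balayage `μ^{*A}`: the measure of minimal potential in `Λ*_{A,μ}`. -/
def IsOuterBal (κ : X → X → ℝ≥0∞) (A : Set X) (μ b : Measure X) : Prop :=
  b ∈ OuterLam κ A μ ∧ ∀ ν ∈ OuterLam κ A μ, ∀ x, pot κ b x ≤ pot κ ν x

/-- The strong (energy) distance `‖μ − ν‖`. -/
noncomputable def strDist (κ : X → X → ℝ≥0∞) (μ ν : Measure X) : ℝ :=
  Real.sqrt ((energy κ μ μ).toReal - 2 * (energy κ μ ν).toReal + (energy κ ν ν).toReal)

/-- The energy principle (strict positive definiteness). -/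
def EnergyPrinciple (κ : X → X → ℝ≥0∞) : Prop :=
  ∀ μ ∈ Eplus κ, ∀ ν ∈ Eplus κ,
    2 * energy κ μ ν ≤ energy κ μ μ + energy κ ν ν ∧
      (2 * energy κ μ ν = energy κ μ μ + energy κ ν ν → μ = ν)

/-- Vague convergence of a net of measures along a filter. -/
def VagueConv {ι : Type*} (F : Filter ι) (m : ι → Measure X) (ν : Measure X) : Prop :=
  ∀ f : X → ℝ, Continuous f → HasCompactSupport f →
    Tendsto (fun i => ∫ x, f x ∂(m i)) F (nhds (∫ x, f x ∂ν))

/-- A net of measures is strong Cauchy (for the energy metric) along a filter. -/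
def StrongCauchy (κ : X → X → ℝ≥0∞) {ι : Type*} (F : Filter ι) (m : ι → Measure X) : Prop :=
  ∀ ε : ℝ, 0 < ε → ∃ s ∈ F, ∀ i ∈ s, ∀ j ∈ s, strDist κ (m i) (m j) < ε

/-- The consistency principle: every strong Cauchy net in `E⁺` converges strongly
to each of its vague limit points. -/
def Consistent (κ : X → X → ℝ≥0∞) : Prop :=
  ∀ (ι : Type) (F : Filter ι) (m : ι → Measure X), F.NeBot →
    (∀ i, m i ∈ Eplus κ) → StrongCauchy κ F m →
    ∀ ν : Measure X, (∃ G : Filter ι, G ≤ F ∧ G.NeBot ∧ VagueConv G m ν) →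
      Tendsto (fun i => strDist κ (m i) ν) F (nhds 0)

/-- The domination principle. -/
def Domination (κ : X → X → ℝ≥0∞) : Prop :=
  ∀ μ ∈ Eplus κ, ∀ ν ∈ Eplus κ,
    (∀ᵐ x ∂μ, pot κ μ x ≤ pot κ ν x) → ∀ x, pot κ μ x ≤ pot κ ν x

/-- A kernel: symmetric and lower semicontinuous. -/
structure IsKernel (κ : X → X → ℝ≥0∞) : Prop where
  symm : ∀ x y, κ x y = κ y x
  lsc : LowerSemicontinuous (Function.uncurry κ)

/-- `E'_A`: the strong closure of `E⁺_A` within `E⁺`. -/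
def EclosOn (κ : X → X → ℝ≥0∞) (A : Set X) : Set (Measure X) :=
  {ν ∈ Eplus κ | ∀ ε : ℝ, 0 < ε → ∃ μ ∈ EplusOn κ A, strDist κ ν μ < ε}

/-- The (real-valued) potential of the signed measure `λ = lp − lm`. -/
noncomputable def spot (κ : X → X → ℝ≥0∞) (lp lm : Measure X) (x : X) : ℝ :=
  (pot κ lp x).toReal - (pot κ lm x).toReal

/-- Assumption (A2): every `f ∈ C_c(X)` is the limit, uniformly with supports in one fixed
compact set, of a sequence of potentials of signed measures of finite energy that are
continuous and compactly supported. -/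
def A2 (κ : X → X → ℝ≥0∞) : Prop :=
  ∀ f : X → ℝ, Continuous f → HasCompactSupport f →
    ∃ (K : Set X) (lp lm : ℕ → Measure X), IsCompact K ∧ tsupport f ⊆ K ∧
      (∀ j, lp j ∈ Eplus κ ∧ lm j ∈ Eplus κ) ∧
      (∀ j x, pot κ (lp j) x ≠ ⊤ ∨ pot κ (lm j) x ≠ ⊤) ∧
      (∀ j, Continuous (spot κ (lp j) (lm j))) ∧
      (∀ j, tsupport (spot κ (lp j) (lm j)) ⊆ K) ∧
      TendstoUniformly (fun j => spot κ (lp j) (lm j)) f atTop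

open scoped CompactlySupported

set_option linter.unusedSectionVars false

/-! ### Positive semidefinite forms on cones -/

section Gram

variable {M : Type*} [AddCommMonoid M] [Module ℝ≥0 M]

/-- The squared distance associated with a symmetric form on a cone. -/
def sqDist (B : M →ₗ[ℝ≥0] M →ₗ[ℝ≥0] ℝ) (a b : M) : ℝ :=
  B a a - 2 * B a b + B b b

/-- A symmetric nonnegative form on a cone whose squared distance is nonnegative. -/
structure IsGram (B : M →ₗ[ℝ≥0] M →ₗ[ℝ≥0] ℝ) : Prop where
  symm : ∀ a b, B a b = B b a
  nonneg : ∀ a b, 0 ≤ B a b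
  sqDist_nonneg : ∀ a b, 0 ≤ sqDist B a b

/-- Convergence of a sequence in the metric of a form. -/
def StrongLim (B : M →ₗ[ℝ≥0] M →ₗ[ℝ≥0] ℝ) (u : ℕ → M) (a : M) : Prop :=
  Tendsto (fun n => sqDist B (u n) a) atTop (𝓝 0)

/-- Cauchy sequences in the metric of a form. -/
def StrongCauchySeq (B : M →ₗ[ℝ≥0] M →ₗ[ℝ≥0] ℝ) (u : ℕ → M) : Prop :=
  ∀ ε : ℝ, 0 < ε → ∃ N, ∀ m ≥ N, ∀ n ≥ N, sqDist B (u m) (u n) < ε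

/-- Strong completeness of a cone. -/
def StrongComplete (B : M →ₗ[ℝ≥0] M →ₗ[ℝ≥0] ℝ) : Prop :=
  ∀ u : ℕ → M, StrongCauchySeq B u → ∃ a, StrongLim B u a

variable {B : M →ₗ[ℝ≥0] M →ₗ[ℝ≥0] ℝ}

namespace IsGram

lemma sqDist_comm (h : IsGram B) (a b : M) : sqDist B a b = sqDist B b a := by
  simp only [sqDist, h.symm a b]; ring

lemma sqDist_triangle (h : IsGram B) (a b c : M) :
    sqDist B a c ≤ 2 * sqDist B a b + 2 * sqDist B b c := by
  have := h.sqDist_nonneg (a + c) ((2 : ℝ≥0) • b)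
  simp only [sqDist, map_add, LinearMap.add_apply, map_smul, LinearMap.smul_apply,
    NNReal.smul_def, smul_eq_mul, NNReal.coe_ofNat] at this ⊢
  rw [h.symm c a, h.symm c b] at this
  linarith

lemma self_add_le (h : IsGram B) (a b : M) :
    B (a + b) (a + b) ≤ 2 * B a a + 2 * B b b := by
  have := h.sqDist_nonneg a b
  simp only [sqDist, map_add, LinearMap.add_apply] at this ⊢
  rw [h.symm b a]
  linarith

lemma sq_sub_le (h : IsGram B) (s a b : M) :
    (B s a - B s b) ^ 2 ≤ B s s * sqDist B a b := by
  have key : ∀ t : ℝ, 0 ≤ B s s * (t * t) + 2 * (B s a - B s b) * t + sqDist B a b := by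
    intro t
    rcases le_total 0 t with ht | ht
    · lift t to ℝ≥0 using ht
      have := h.sqDist_nonneg (a + t • s) b
      simp only [sqDist, map_add, LinearMap.add_apply, map_smul, LinearMap.smul_apply,
        NNReal.smul_def, smul_eq_mul] at this ⊢
      rw [h.symm a s] at this
      linarith
    · obtain ⟨t, rfl⟩ : ∃ r : ℝ, t = -r := ⟨-t, by ring⟩
      have ht' : 0 ≤ t := by linarith
      lift t to ℝ≥0 using ht'
      have := h.sqDist_nonneg a (b + t • s)
      simp only [sqDist, map_add, LinearMap.add_apply, map_smul, LinearMap.smul_apply,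
        NNReal.smul_def, smul_eq_mul] at this ⊢
      rw [h.symm a s, h.symm b s] at this
      linarith
  have := discrim_le_zero key
  simp only [discrim] at this
  linarith

lemma sq_le (h : IsGram B) (a b : M) : B a b ^ 2 ≤ B a a * B b b := by
  have := h.sq_sub_le a b 0
  simpa [sqDist] using this

lemma two_mul_le (h : IsGram B) (a b : M) : 2 * B a b ≤ B a a + B b b := by
  have := h.sqDist_nonneg a b
  simp only [sqDist] at this
  linarith

lemma tendsto_left (h : IsGram B) {u : ℕ → M} {a : M} (hu : StrongLim B u a) (s : M) :
    Tendsto (fun n => B s (u n)) atTop (𝓝 (B s a)) := by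
  rw [tendsto_iff_dist_tendsto_zero]
  have h1 : Tendsto (fun n => √(B s s * sqDist B (u n) a)) atTop (𝓝 0) := by
    have := (hu.const_mul (B s s)).sqrt
    simpa using this
  refine squeeze_zero (fun _ => dist_nonneg) (fun n => ?_) h1
  rw [Real.dist_eq]
  exact Real.abs_le_sqrt (h.sq_sub_le s (u n) a)

lemma tendsto_self (h : IsGram B) {u : ℕ → M} {a : M} (hu : StrongLim B u a) :
    Tendsto (fun n => B (u n) (u n)) atTop (𝓝 (B a a)) := by
  have h1 := hu.add ((h.tendsto_left hu a).const_mul 2) |>.sub_const (B a a)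
  refine (h1.congr fun n => ?_).trans (by simp; linarith)
  simp only [sqDist, h.symm a (u n)]; ring

lemma tendsto_sqDist (h : IsGram B) {u : ℕ → M} {a : M} (hu : StrongLim B u a) (s : M) :
    Tendsto (fun n => sqDist B (u n) s) atTop (𝓝 (sqDist B a s)) := by
  have := ((h.tendsto_self hu).sub ((h.tendsto_left hu s).const_mul 2)).add_const (B s s)
  refine (this.congr fun n => ?_).trans (by rw [sqDist, h.symm a s])
  simp only [sqDist, h.symm s (u n)]

lemma cauchy_of_lim (h : IsGram B) {u : ℕ → M} {a : M} (hu : StrongLim B u a) :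
    StrongCauchySeq B u := by
  intro ε hε
  obtain ⟨N, hN⟩ :=
    (hu.eventually (gt_mem_nhds (show (0 : ℝ) < ε / 4 by positivity))).exists_forall_of_atTop
  refine ⟨N, fun m hm n hn => ?_⟩
  have h1 := h.sqDist_triangle (u m) a (u n)
  have h2 := hN m hm
  have h3 := hN n hn
  rw [h.sqDist_comm a (u n)] at h1
  linarith

lemma bounded_of_cauchy (h : IsGram B) {u : ℕ → M} (hu : StrongCauchySeq B u) :
    ∃ C : ℝ, ∃ N, ∀ n ≥ N, B (u n) (u n) ≤ C := by
  obtain ⟨N, hN⟩ := hu 1 one_pos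
  refine ⟨2 + 2 * B (u N) (u N), N, fun n hn => ?_⟩
  have h1 := h.sqDist_triangle (u n) (u N) 0
  have h2 := hN n hn N le_rfl
  simp only [sqDist, map_zero] at h1 h2
  linarith

/-- `u` is a maximizing sequence of the quadratic functional `2ℓ - B` over a cone `F`. -/
lemma exists_cauchy_maximizing (h : IsGram B) (F : Submodule ℝ≥0 M) (ℓ : M →ₗ[ℝ≥0] ℝ)
    {C : ℝ} (hC : ∀ a ∈ F, 2 * ℓ a - B a a ≤ C) :
    ∃ u : ℕ → M, ∃ S : ℝ, (∀ n, u n ∈ F) ∧ StrongCauchySeq B u ∧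
      (∀ a ∈ F, 2 * ℓ a - B a a ≤ S) ∧
      Tendsto (fun n => 2 * ℓ (u n) - B (u n) (u n)) atTop (𝓝 S) := by
  set J : M → ℝ := fun a => 2 * ℓ a - B a a with hJ
  have hne : (J '' F).Nonempty := ⟨_, 0, F.zero_mem, rfl⟩
  have hbd : BddAbove (J '' F) := ⟨C, by rintro _ ⟨a, ha, rfl⟩; exact hC a ha⟩
  set S := sSup (J '' F) with hS
  have hle : ∀ a ∈ F, J a ≤ S := fun a ha => le_csSup hbd ⟨a, ha, rfl⟩
  have hex : ∀ n : ℕ, ∃ a ∈ F, S - 1 / ((n : ℝ) + 1) < J a := by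
    intro n
    obtain ⟨_, ⟨a, ha, rfl⟩, hlt⟩ := exists_lt_of_lt_csSup hne
      (show S - 1 / ((n : ℝ) + 1) < S by have : 0 < 1 / ((n : ℝ) + 1) := by positivity
                                         linarith)
    exact ⟨a, ha, hlt⟩
  choose u huF hu using hex
  have hmid : ∀ m n, sqDist B (u m) (u n) ≤ 2 / ((m : ℝ) + 1) + 2 / ((n : ℝ) + 1) := by
    intro m n
    have h1 := hle ((1 / 2 : ℝ≥0) • (u m + u n)) (F.smul_mem _ (F.add_mem (huF m) (huF n)))
    have h2 := hu m
    have h3 := hu n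
    simp only [hJ, sqDist, map_add, LinearMap.add_apply, map_smul, LinearMap.smul_apply,
      NNReal.smul_def, smul_eq_mul] at h1 h2 h3 ⊢
    push_cast at h1
    rw [h.symm (u n) (u m)] at h1
    have e1 : 2 / ((m : ℝ) + 1) = 2 * (1 / ((m : ℝ) + 1)) := by ring
    have e2 : 2 / ((n : ℝ) + 1) = 2 * (1 / ((n : ℝ) + 1)) := by ring
    rw [e1, e2]
    linarith
  refine ⟨u, S, huF, ?_, hle, ?_⟩
  · intro ε hε
    obtain ⟨N, hN⟩ := exists_nat_one_div_lt (show 0 < ε / 4 by positivity)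
    refine ⟨N, fun m hm n hn => (hmid m n).trans_lt ?_⟩
    have e1 : 1 / ((m : ℝ) + 1) ≤ 1 / ((N : ℝ) + 1) := by gcongr
    have e2 : 1 / ((n : ℝ) + 1) ≤ 1 / ((N : ℝ) + 1) := by gcongr
    have e3 : 2 / ((m : ℝ) + 1) = 2 * (1 / ((m : ℝ) + 1)) := by ring
    have e4 : 2 / ((n : ℝ) + 1) = 2 * (1 / ((n : ℝ) + 1)) := by ring
    rw [e3, e4]
    linarith
  · refine tendsto_of_tendsto_of_tendsto_of_le_of_le (g := fun n : ℕ => S - 1 / ((n : ℝ) + 1))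
      ?_ tendsto_const_nhds (fun n => (hu n).le) (fun n => hle _ (huF n))
    simpa using tendsto_const_nhds.sub (tendsto_one_div_add_atTop_nhds_zero_nat (𝕜 := ℝ))

/-- The maximizer of `2ℓ - B` over the strong closure of a cone `F`. -/
lemma exists_maximizer (h : IsGram B) (hc : StrongComplete B) (F : Submodule ℝ≥0 M)
    (ℓ : M →ₗ[ℝ≥0] ℝ) {C : ℝ} (hC : ∀ a ∈ F, 2 * ℓ a - B a a ≤ C)
    (hcont : ∀ u a, StrongLim B u a → Tendsto (fun n => ℓ (u n)) atTop (𝓝 (ℓ a))) :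
    ∃ p : M, (∃ u : ℕ → M, (∀ n, u n ∈ F) ∧ StrongLim B u p) ∧
      (∀ a ∈ F, ℓ a ≤ B p a) ∧ B p p = ℓ p := by
  obtain ⟨u, S, huF, hucau, hle, huS⟩ := h.exists_cauchy_maximizing F ℓ hC
  obtain ⟨p, hp⟩ := hc u hucau
  have hJp : 2 * ℓ p - B p p = S :=
    tendsto_nhds_unique (((hcont u p hp).const_mul 2).sub (h.tendsto_self hp)) huS
  refine ⟨p, ⟨u, huF, hp⟩, fun a ha => ?_, ?_⟩
  · have key : ∀ t : ℝ≥0, 2 * t * (ℓ a - B p a) ≤ t ^ 2 * B a a := by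
      intro t
      have h1 : ∀ n, (2 * ℓ (u n) - B (u n) (u n)) + 2 * t * ℓ a - 2 * t * B a (u n)
          - t ^ 2 * B a a ≤ S := by
        intro n
        have := hle (u n + t • a) (F.add_mem (huF n) (F.smul_mem _ ha))
        simp only [map_add, LinearMap.add_apply, map_smul, LinearMap.smul_apply,
          NNReal.smul_def, smul_eq_mul, h.symm (u n) a] at this
        linarith
      have h2 := le_of_tendsto' (((huS.add_const (2 * t * ℓ a)).sub
        ((h.tendsto_left hp a).const_mul (2 * (t : ℝ)))).sub_const (t ^ 2 * B a a)) h1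
      rw [h.symm a p] at h2
      linarith
    by_contra! hlt
    have hd : 0 < ℓ a - B p a := by linarith
    have hb := h.nonneg a a
    have h3 := key (Real.toNNReal ((ℓ a - B p a) / (B a a + 1)))
    rw [Real.coe_toNNReal _ (by positivity)] at h3
    have h4 : ((ℓ a - B p a) / (B a a + 1)) ^ 2 * B a a
        ≤ (ℓ a - B p a) / (B a a + 1) * (ℓ a - B p a) := by
      have : (ℓ a - B p a) / (B a a + 1) * B a a ≤ ℓ a - B p a := by
        rw [div_mul_eq_mul_div, div_le_iff₀ (by positivity)]
        nlinarith
      rw [sq, mul_assoc]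
      gcongr
    have h5 : 0 < (ℓ a - B p a) / (B a a + 1) * (ℓ a - B p a) := by positivity
    linarith
  · have key : ∀ c : ℝ≥0, 2 * c * ℓ p - c ^ 2 * B p p ≤ 2 * ℓ p - B p p := by
      intro c
      have h1 : ∀ n, 2 * c * ℓ (u n) - c ^ 2 * B (u n) (u n) ≤ S := by
        intro n
        have := hle (c • u n) (F.smul_mem _ (huF n))
        simp only [map_smul, LinearMap.smul_apply, NNReal.smul_def, smul_eq_mul] at this
        linarith
      rw [hJp]
      exact le_of_tendsto' (((hcont u p hp).const_mul (2 * (c : ℝ))).sub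
        ((h.tendsto_self hp).const_mul ((c : ℝ) ^ 2))) h1
    have hb := h.nonneg p p
    have k0 := key 0
    have k2 := key 2
    rcases hb.eq_or_lt with hb | hb
    · rw [← hb] at k0 k2 ⊢
      push_cast at k0 k2
      linarith
    · have k3 := key (Real.toNNReal (ℓ p / B p p))
      have hl : 0 ≤ ℓ p := by push_cast at k0; linarith
      rw [Real.coe_toNNReal _ (by positivity)] at k3
      have e1 : 2 * (ℓ p / B p p) * ℓ p - (ℓ p / B p p) ^ 2 * B p p = ℓ p ^ 2 / B p p := by
        field_simp; ring
      rw [e1, div_le_iff₀ hb] at k3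
      have : (ℓ p - B p p) ^ 2 ≤ 0 := by nlinarith
      nlinarith [sq_nonneg (ℓ p - B p p),
        pow_eq_zero_iff (two_ne_zero) |>.1 (le_antisymm this (sq_nonneg _))]

lemma cauchySeq_left (h : IsGram B) {u : ℕ → M} (hu : StrongCauchySeq B u) (s : M) :
    CauchySeq fun n => B s (u n) := by
  refine Metric.cauchySeq_iff.2 fun ε hε => ?_
  have hs : 0 ≤ B s s := h.nonneg s s
  obtain ⟨N, hN⟩ := hu (ε ^ 2 / (B s s + 1)) (by positivity)
  refine ⟨N, fun m hm n hn => ?_⟩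
  rw [Real.dist_eq]
  refine abs_lt_of_sq_lt_sq ?_ hε.le
  have h1 := h.sq_sub_le s (u m) (u n)
  have h2 := hN m hm n hn
  rw [lt_div_iff₀ (by positivity)] at h2
  have h3 := h.sqDist_nonneg (u m) (u n)
  nlinarith

lemma apply_half_add (h : IsGram B) (a b : M) :
    4 * B ((2⁻¹ : ℝ≥0) • (a + b)) ((2⁻¹ : ℝ≥0) • (a + b)) =
      2 * B a a + 2 * B b b - sqDist B a b := by
  simp only [sqDist, map_add, LinearMap.add_apply, map_smul, LinearMap.smul_apply,
    NNReal.smul_def, smul_eq_mul, NNReal.coe_inv, NNReal.coe_ofNat, h.symm b a]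
  ring

/-- Almost norm-minimizing elements of a decreasing sequence of midpoint convex sets. -/
lemma exists_cauchy_minimizing (h : IsGram B) (N : ℕ → Set M) (hanti : Antitone N)
    (hmid : ∀ n, ∀ a ∈ N n, ∀ b ∈ N n, (2⁻¹ : ℝ≥0) • (a + b) ∈ N n) {t : ℝ}
    (ht : ∀ n, ∀ ε > 0, ∃ a ∈ N n, B a a < t + ε) :
    ∃ u : ℕ → M, (∀ n, u n ∈ N n) ∧ StrongCauchySeq B u ∧
      ∀ n, B (u n) (u n) ≤ t + 1 / ((n : ℝ) + 1) := by
  set c : ℕ → ℝ := fun n => sInf ((fun a => B a a) '' N n) with hc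
  have hne : ∀ n, ((fun a => B a a) '' N n).Nonempty := fun n =>
    let ⟨a, ha, _⟩ := ht n 1 one_pos; ⟨_, a, ha, rfl⟩
  have hbdd : ∀ n, BddBelow ((fun a => B a a) '' N n) := fun n =>
    ⟨0, by rintro _ ⟨a, -, rfl⟩; exact h.nonneg a a⟩
  have hle : ∀ n, ∀ a ∈ N n, c n ≤ B a a := fun n a ha => csInf_le (hbdd n) ⟨a, ha, rfl⟩
  have hct : ∀ n, c n ≤ t := fun n => le_of_forall_pos_le_add fun ε hε => by
    obtain ⟨a, ha, hlt⟩ := ht n ε hε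
    exact (hle n a ha).trans hlt.le
  have hmono : Monotone c := fun m n hmn => csInf_le_csInf (hbdd m) (hne n) (image_mono (hanti hmn))
  have hex : ∀ n, ∃ a ∈ N n, B a a < c n + 1 / ((n : ℝ) + 1) := fun n => by
    obtain ⟨_, ⟨a, ha, rfl⟩, hlt⟩ := exists_lt_of_csInf_lt (hne n)
      (lt_add_of_pos_right (c n) (Nat.one_div_pos_of_nat (n := n) (α := ℝ)))
    exact ⟨a, ha, hlt⟩
  choose u hu hlt using hex
  refine ⟨u, hu, ?_, fun n => by linarith [hlt n, hct n]⟩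
  have hlim := tendsto_atTop_ciSup hmono ⟨t, by rintro _ ⟨n, rfl⟩; exact hct n⟩
  have hcau := Metric.cauchySeq_iff.1 hlim.cauchySeq
  have key : ∀ m n, m ≤ n → sqDist B (u m) (u n)
      ≤ 2 * (c n - c m) + 2 * (1 / ((m : ℝ) + 1)) + 2 * (1 / ((n : ℝ) + 1)) := fun m n hmn => by
    have h1 := hle m _ (hmid m _ (hu m) _ (hanti hmn (hu n)))
    have h2 := h.apply_half_add (u m) (u n)
    linarith [hlt m, hlt n]
  intro ε hε
  obtain ⟨N₁, hN₁⟩ := hcau (ε / 8) (by positivity)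
  obtain ⟨N₂, hN₂⟩ := exists_nat_one_div_lt (show (0 : ℝ) < ε / 8 by positivity)
  have hsmall : ∀ n ≥ N₂, 1 / ((n : ℝ) + 1) < ε / 8 := fun n hn =>
    (Nat.one_div_le_one_div hn).trans_lt hN₂
  have key' : ∀ m ≥ max N₁ N₂, ∀ n ≥ m, sqDist B (u m) (u n) < ε := fun m hm n hn => by
    simp only [ge_iff_le, max_le_iff] at hm hn
    have h1 := hN₁ n (hm.1.trans hn) m hm.1
    rw [Real.dist_eq] at h1
    have h2 := (abs_lt.1 h1).2
    linarith [key m n hn, hsmall m hm.2, hsmall n (hm.2.trans hn)]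
  refine ⟨max N₁ N₂, fun m hm n hn => ?_⟩
  rcases le_total m n with hmn | hmn
  · exact key' m hm n hmn
  · rw [h.sqDist_comm]
    exact key' n hn m hmn

lemma sum_apply_sum_le (h : IsGram B) {p : ℕ → M} {r : ℕ → ℝ} (hr : ∀ k, 0 ≤ r k)
    (hp : ∀ k, B (p k) (p k) ≤ r k ^ 2) (s : Finset ℕ) :
    B (∑ k ∈ s, p k) (∑ k ∈ s, p k) ≤ (∑ k ∈ s, r k) ^ 2 := by
  rw [sq, Finset.sum_mul_sum]
  simp only [map_sum, LinearMap.sum_apply]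
  refine (Finset.sum_comm).trans_le (Finset.sum_le_sum fun i _ => Finset.sum_le_sum fun j _ => ?_)
  refine le_of_sq_le_sq ?_ (mul_nonneg (hr i) (hr j))
  calc B (p i) (p j) ^ 2 ≤ B (p i) (p i) * B (p j) (p j) := h.sq_le _ _
    _ ≤ r i ^ 2 * r j ^ 2 := mul_le_mul (hp i) (hp j) (h.nonneg _ _) (sq_nonneg _)
    _ = (r i * r j) ^ 2 := by ring

/-- Absolutely convergent series in a strongly complete cone. -/
lemma exists_sum (h : IsGram B) (hc : StrongComplete B) {p : ℕ → M} {r : ℕ → ℝ}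
    (hr : ∀ k, 0 ≤ r k) (hp : ∀ k, B (p k) (p k) ≤ r k ^ 2) {R : ℝ} (hR : HasSum r R) :
    ∃ q, B q q ≤ R ^ 2 ∧ ∀ t n, B t (∑ k ∈ Finset.range n, p k) ≤ B t q := by
  set s : ℕ → M := fun n => ∑ k ∈ Finset.range n, p k with hs
  have hdist : ∀ m n, m ≤ n → sqDist B (s m) (s n)
      ≤ (∑ k ∈ Finset.range n, r k - ∑ k ∈ Finset.range m, r k) ^ 2 := fun m n hmn => by
    have h1 : s n = s m + ∑ k ∈ Finset.Ico m n, p k := (Finset.sum_range_add_sum_Ico p hmn).symm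
    have h2 : ∑ k ∈ Finset.range n, r k - ∑ k ∈ Finset.range m, r k = ∑ k ∈ Finset.Ico m n, r k :=
      (Finset.sum_Ico_eq_sub r hmn).symm
    rw [h2, h1]
    refine le_trans (le_of_eq ?_) (h.sum_apply_sum_le hr hp (Finset.Ico m n))
    simp only [sqDist, map_add, LinearMap.add_apply]
    rw [h.symm (∑ k ∈ Finset.Ico m n, p k) (s m)]
    ring
  have hcau := Metric.cauchySeq_iff.1 hR.tendsto_sum_nat.cauchySeq
  obtain ⟨q, hq⟩ := hc s fun ε hε => by
    obtain ⟨N, hN⟩ := hcau (√ε) (Real.sqrt_pos.2 hε)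
    have key : ∀ m ≥ N, ∀ n ≥ m, sqDist B (s m) (s n) < ε := fun m hm n hn => by
      refine (hdist m n hn).trans_lt ?_
      have h1 := hN n (le_trans hm hn) m hm
      rw [Real.dist_eq, Real.lt_sqrt (abs_nonneg _), sq_abs] at h1
      exact h1
    refine ⟨N, fun m hm n hn => ?_⟩
    rcases le_total m n with hmn | hmn
    · exact key m hm n hmn
    · rw [h.sqDist_comm]
      exact key n hn m hmn
  refine ⟨q, le_of_tendsto' (h.tendsto_self hq) fun n => ?_, fun t n => ?_⟩
  · refine (h.sum_apply_sum_le hr hp _).trans ?_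
    exact pow_le_pow_left₀ (Finset.sum_nonneg fun k _ => hr k)
      (sum_le_hasSum _ (fun k _ => hr k) hR) 2
  · refine Monotone.ge_of_tendsto (monotone_nat_of_le_succ fun k => ?_) (h.tendsto_left hq t) n
    simp only [hs, Finset.sum_range_succ, map_add]
    linarith [h.nonneg t (p k)]

/-- The positive part of a difference. -/
lemma exists_le_add (h : IsGram B) (hc : StrongComplete B) (a b : M) :
    ∃ p, B p p ≤ sqDist B a b ∧ ∀ t, B t a ≤ B t b + B t p := by
  have hbd : ∀ p, 2 * (B a - B b) p - B p p ≤ sqDist B a b := fun p => by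
    have := h.sqDist_nonneg a (b + p)
    simp only [sqDist, map_add, LinearMap.add_apply, LinearMap.sub_apply] at this ⊢
    rw [h.symm p b] at this
    linarith
  obtain ⟨p, -, h1, h2⟩ := h.exists_maximizer hc ⊤ (B a - B b) (fun p _ => hbd p)
    fun u p hu => (h.tendsto_left hu a).sub (h.tendsto_left hu b)
  refine ⟨p, by linarith [hbd p], fun t => ?_⟩
  have := h1 t trivial
  simp only [LinearMap.sub_apply] at this
  rw [h.symm t a, h.symm t b, h.symm t p]
  linarith

end IsGram

end Gram

section Measures

variable [SecondCountableTopology X] {κ : X → X → ℝ≥0∞} {μ ν τ : Measure X}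

/-! ### Potentials and energies -/

lemma isRadon_iff : IsRadon μ ↔ IsLocallyFiniteMeasure μ := by
  refine ⟨fun h => h.2, fun h => ⟨?_, h⟩⟩
  let := TopologicalSpace.pseudoMetrizableSpacePseudoMetric X
  infer_instance

lemma regular_of_mem (h : μ ∈ Eplus κ) : μ.Regular := by
  have := h.1.2
  let := TopologicalSpace.pseudoMetrizableSpacePseudoMetric X
  infer_instance

lemma sigmaFinite_of_mem (h : μ ∈ Eplus κ) : SigmaFinite μ := by
  have := h.1.2
  infer_instance

lemma mem_Eplus_of_le (h : ν ∈ Eplus κ) (hle : μ ≤ ν) : μ ∈ Eplus κ := by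
  have := h.1.2
  refine ⟨isRadon_iff.2 (Measure.isLocallyFiniteMeasure_of_le hle), lt_of_le_of_lt ?_ h.2⟩
  exact lintegral_mono' hle fun x => lintegral_mono' hle le_rfl

lemma restrict_mem (h : μ ∈ Eplus κ) (s : Set X) : μ.restrict s ∈ Eplus κ :=
  mem_Eplus_of_le h Measure.restrict_le_self

namespace IsKernel

lemma measurable_pot [SFinite μ] (hk : IsKernel κ) : Measurable (pot κ μ) :=
  hk.lsc.measurable.lintegral_prod_right'

lemma lowerSemicontinuous_pot (hk : IsKernel κ) : LowerSemicontinuous (pot κ μ) := by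
  intro x
  refine lowerSemicontinuousAt_iff_le_liminf.2 ?_
  have hm : ∀ z, Measurable (κ z) := fun z =>
    (LowerSemicontinuous.comp hk.lsc (Continuous.prodMk_right z)).measurable
  refine le_trans (lintegral_mono fun y => ?_) (lintegral_liminf_le (u := 𝓝 x) hm)
  exact lowerSemicontinuousAt_iff_le_liminf.1
    ((LowerSemicontinuous.comp hk.lsc (Continuous.prodMk_left y)).lowerSemicontinuousAt x)

lemma energy_comm [SFinite μ] [SFinite ν] (hk : IsKernel κ) :
    energy κ μ ν = energy κ ν μ := by
  unfold energy pot
  rw [lintegral_lintegral_swap hk.lsc.measurable.aemeasurable]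
  simp only [hk.symm]

end IsKernel

lemma pot_add (κ : X → X → ℝ≥0∞) (μ ν : Measure X) (x : X) :
    pot κ (μ + ν) x = pot κ μ x + pot κ ν x :=
  lintegral_add_measure _ _ _

lemma pot_smul (κ : X → X → ℝ≥0∞) (c : ℝ≥0) (μ : Measure X) (x : X) :
    pot κ (c • μ) x = c * pot κ μ x := by
  rw [pot, lintegral_smul_measure, ENNReal.smul_def, smul_eq_mul, pot]

lemma energy_add_left (κ : X → X → ℝ≥0∞) (μ ν τ : Measure X) :
    energy κ (μ + ν) τ = energy κ μ τ + energy κ ν τ :=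
  lintegral_add_measure _ _ _

lemma energy_smul_left (κ : X → X → ℝ≥0∞) (c : ℝ≥0) (μ τ : Measure X) :
    energy κ (c • μ) τ = c * energy κ μ τ := by
  rw [energy, lintegral_smul_measure, ENNReal.smul_def, smul_eq_mul, energy]

lemma energy_lt_top (hE : EnergyPrinciple κ) (hμ : μ ∈ Eplus κ) (hν : ν ∈ Eplus κ) :
    energy κ μ ν < ⊤ := by
  have h1 := (hE μ hμ ν hν).1
  have h2 : energy κ μ μ + energy κ ν ν < ⊤ := ENNReal.add_lt_top.2 ⟨hμ.2, hν.2⟩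
  have h3 : energy κ μ ν ≤ 2 * energy κ μ ν := by rw [two_mul]; exact le_self_add
  exact (h3.trans h1).trans_lt h2

lemma energy_comm (hk : IsKernel κ) (hμ : μ ∈ Eplus κ) (hν : ν ∈ Eplus κ) :
    energy κ μ ν = energy κ ν μ := by
  have := sigmaFinite_of_mem hμ
  have := sigmaFinite_of_mem hν
  exact hk.energy_comm

/-- `E⁺` as a cone of measures. -/
def cone (hk : IsKernel κ) (hE : EnergyPrinciple κ) : Submodule ℝ≥0 (Measure X) where
  carrier := Eplus κ
  zero_mem' := ⟨isRadon_iff.2 inferInstance, by simp [energy]⟩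
  add_mem' {μ ν} hμ hν := by
    have := hμ.1.2
    have := hν.1.2
    have hR : IsRadon (μ + ν) := isRadon_iff.2
      ⟨fun x => by
        obtain ⟨s, hs, hs'⟩ := μ.finiteAt_nhds x
        obtain ⟨t, ht, ht'⟩ := ν.finiteAt_nhds x
        refine ⟨s ∩ t, inter_mem hs ht, ?_⟩
        rw [Measure.add_apply]
        exact ENNReal.add_lt_top.2 ⟨(measure_mono inter_subset_left).trans_lt hs',
          (measure_mono inter_subset_right).trans_lt ht'⟩⟩
    have := hR.2
    refine ⟨hR, ?_⟩
    rw [energy_add_left, hk.energy_comm (μ := μ), hk.energy_comm (μ := ν), energy_add_left,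
      energy_add_left]
    simp [ENNReal.add_lt_top, energy_lt_top hE, hμ, hν]
  smul_mem' c μ hμ := by
    have := hμ.1.2
    refine ⟨isRadon_iff.2 inferInstance, ?_⟩
    rw [energy_smul_left, hk.energy_comm, energy_smul_left]
    exact ENNReal.mul_lt_top (by simp) (ENNReal.mul_lt_top (by simp) hμ.2)

/-- The mutual energy as a bilinear form on the cone `E⁺`. -/
noncomputable def form (hk : IsKernel κ) (hE : EnergyPrinciple κ) :
    cone hk hE →ₗ[ℝ≥0] cone hk hE →ₗ[ℝ≥0] ℝ :=
  LinearMap.mk₂ ℝ≥0 (fun a b => (energy κ a b).toReal)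
    (fun a b c => by
      rw [Submodule.coe_add, energy_add_left, ENNReal.toReal_add]
      · exact (energy_lt_top hE a.2 c.2).ne
      · exact (energy_lt_top hE b.2 c.2).ne)
    (fun c a b => by
      rw [Submodule.coe_smul, energy_smul_left, ENNReal.toReal_mul]; rfl)
    (fun a b c => by
      rw [energy_comm hk a.2 (b + c).2, Submodule.coe_add, energy_add_left, ENNReal.toReal_add,
        energy_comm hk b.2 a.2, energy_comm hk c.2 a.2]
      · exact (energy_lt_top hE b.2 a.2).ne
      · exact (energy_lt_top hE c.2 a.2).ne)
    (fun c a b => by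
      rw [energy_comm hk a.2 (c • b).2, Submodule.coe_smul, energy_smul_left,
        ENNReal.toReal_mul, energy_comm hk b.2 a.2]; rfl)

lemma form_apply (hk : IsKernel κ) (hE : EnergyPrinciple κ) (a b : cone hk hE) :
    form hk hE a b = (energy κ a b).toReal := rfl

lemma ofReal_form (hk : IsKernel κ) (hE : EnergyPrinciple κ) (a b : cone hk hE) :
    ENNReal.ofReal (form hk hE a b) = energy κ a b :=
  ENNReal.ofReal_toReal (energy_lt_top hE a.2 b.2).ne

lemma form_le_iff (hk : IsKernel κ) (hE : EnergyPrinciple κ) (a b c d : cone hk hE) :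
    form hk hE a b ≤ form hk hE c d ↔ energy κ a b ≤ energy κ c d :=
  ENNReal.toReal_le_toReal (energy_lt_top hE a.2 b.2).ne (energy_lt_top hE c.2 d.2).ne

lemma isGram_form (hk : IsKernel κ) (hE : EnergyPrinciple κ) : IsGram (form hk hE) where
  symm a b := by rw [form_apply, form_apply, energy_comm hk a.2 b.2]
  nonneg a b := ENNReal.toReal_nonneg
  sqDist_nonneg a b := by
    have h1 := (hE a a.2 b b.2).1
    have h2 := ENNReal.toReal_mono
      (ENNReal.add_lt_top.2 ⟨a.2.2, b.2.2⟩).ne h1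
    rw [ENNReal.toReal_add a.2.2.ne b.2.2.ne, ENNReal.toReal_mul, ENNReal.toReal_ofNat] at h2
    simp only [sqDist, form_apply]
    linarith

lemma eq_of_sqDist_eq_zero (hk : IsKernel κ) (hE : EnergyPrinciple κ) {a b : cone hk hE}
    (h : sqDist (form hk hE) a b = 0) : a = b := by
  refine Subtype.ext ((hE a a.2 b b.2).2 ?_)
  simp only [sqDist, form_apply] at h
  rw [← ENNReal.toReal_eq_toReal_iff'
    (ENNReal.mul_lt_top (by simp) (energy_lt_top hE a.2 b.2)).ne
    (ENNReal.add_lt_top.2 ⟨a.2.2, b.2.2⟩).ne, ENNReal.toReal_add a.2.2.ne b.2.2.ne,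
    ENNReal.toReal_mul, ENNReal.toReal_ofNat]
  linarith

lemma strDist_eq (hk : IsKernel κ) (hE : EnergyPrinciple κ) (a b : cone hk hE) :
    strDist κ a b = √(sqDist (form hk hE) a b) := rfl

lemma ae_pot_le (hk : IsKernel κ) (hE : EnergyPrinciple κ) (hμ : μ ∈ Eplus κ) (hν : ν ∈ Eplus κ)
    (hτ : τ ∈ Eplus κ) (h : energy κ (τ.restrict {x | pot κ ν x < pot κ μ x}) μ
      ≤ energy κ (τ.restrict {x | pot κ ν x < pot κ μ x}) ν) :
    ∀ᵐ x ∂τ, pot κ μ x ≤ pot κ ν x := by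
  have := sigmaFinite_of_mem hμ
  have := sigmaFinite_of_mem hν
  set G := {x | pot κ ν x < pot κ μ x} with hG
  have hGm : MeasurableSet G := measurableSet_lt hk.measurable_pot hk.measurable_pot
  have h2 := energy_lt_top hE (restrict_mem hτ G) hν
  rw [ae_iff]
  simp only [not_le]
  by_contra hne
  refine absurd h (not_le.2 ?_)
  refine lintegral_strict_mono ?_ hk.measurable_pot.aemeasurable h2.ne ?_
  · rwa [Ne, Measure.restrict_eq_zero]
  · exact (ae_restrict_iff' hGm).2 (ae_of_all _ fun x hx => hx)

/-- Domination of energies implies domination of potentials everywhere. -/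
lemma pot_le_of_energy_le (hk : IsKernel κ) (hE : EnergyPrinciple κ) (hD : Domination κ)
    (hμ : μ ∈ Eplus κ) (hν : ν ∈ Eplus κ)
    (h : ∀ τ ∈ Eplus κ, energy κ τ μ ≤ energy κ τ ν) (x : X) : pot κ μ x ≤ pot κ ν x :=
  hD μ hμ ν hν (ae_pot_le hk hE hμ hν hμ (h _ (restrict_mem hμ _))) x

lemma pot_le_iff_form_le (hk : IsKernel κ) (hE : EnergyPrinciple κ) (hD : Domination κ)
    (a b : cone hk hE) : (∀ x, pot κ a x ≤ pot κ b x) ↔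
      ∀ t, form hk hE t a ≤ form hk hE t b := by
  refine ⟨fun h t => (form_le_iff ..).2 (lintegral_mono h), fun h => ?_⟩
  exact pot_le_of_energy_le hk hE hD a.2 b.2 fun τ hτ =>
    (form_le_iff hk hE ⟨τ, hτ⟩ a ⟨τ, hτ⟩ b).1 (h ⟨τ, hτ⟩)

end Measures

section Vague

/-! ### Lower semicontinuity along vague convergence -/

lemma measure_open_le_liminf {u : ℕ → Measure X} {μ : Measure X} [μ.Regular]
    [∀ n, IsLocallyFiniteMeasure (u n)] (hu : VagueConv atTop u μ) {G : Set X} (hG : IsOpen G) :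
    μ G ≤ liminf (fun n => u n G) atTop := by
  rw [hG.measure_eq_iSup_isCompact]
  refine iSup₂_le fun K hKG => iSup_le fun hK => ?_
  obtain ⟨f, hf1, hf0, hfc, hf⟩ := exists_continuous_one_zero_of_isCompact hK hG.isClosed_compl
    (disjoint_compl_right_iff_subset.2 hKG)
  have hi : ∀ (m : Measure X) [IsLocallyFiniteMeasure m],
      ENNReal.ofReal (∫ x, f x ∂m) = ∫⁻ x, ENNReal.ofReal (f x) ∂m := fun m _ =>
    ofReal_integral_eq_lintegral_ofReal (f.continuous.integrable_of_hasCompactSupport hfc)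
      (ae_of_all _ fun x => (hf x).1)
  have h1 : μ K ≤ ENNReal.ofReal (∫ x, f x ∂μ) := by
    rw [hi, ← lintegral_indicator_one hK.measurableSet]
    refine lintegral_mono fun x => ?_
    by_cases hx : x ∈ K
    · simp [hx, hf1 hx]
    · simp [hx]
  have h2 : ∀ n, ENNReal.ofReal (∫ x, f x ∂(u n)) ≤ u n G := by
    intro n
    rw [hi, ← lintegral_indicator_one hG.measurableSet]
    refine lintegral_mono fun x => ?_
    by_cases hx : x ∈ G
    · simp [hx, (hf x).2]
    · have : f x = 0 := hf0 hx
      simp [hx, this]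
  have h3 := ENNReal.tendsto_ofReal (hu f f.continuous hfc)
  exact h1.trans (h3.liminf_eq ▸ liminf_le_liminf (Eventually.of_forall h2))

lemma lintegral_le_liminf {u : ℕ → Measure X} {μ : Measure X} [μ.Regular]
    [∀ n, IsLocallyFiniteMeasure (u n)] (hu : VagueConv atTop u μ) {g : X → ℝ≥0∞}
    (hg : LowerSemicontinuous g) :
    ∫⁻ x, g x ∂μ ≤ liminf (fun n => ∫⁻ x, g x ∂(u n)) atTop := by
  have hgm := hg.measurable
  have hlayer : ∀ (k : ℕ) (m : Measure X), ∫⁻ x, min (g x) k ∂m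
      = ∫⁻ t in Ioi (0 : ℝ), m {x | t < (min (g x) k).toReal} := by
    intro k m
    rw [← lintegral_eq_lintegral_meas_lt m (ae_of_all _ fun x => ENNReal.toReal_nonneg)
      (hgm.min measurable_const).ennreal_toReal.aemeasurable]
    refine lintegral_congr fun x => (ENNReal.ofReal_toReal ?_).symm
    exact (min_le_right _ _).trans_lt (ENNReal.natCast_lt_top k) |>.ne
  have hsup : ∫⁻ x, g x ∂μ = ⨆ k : ℕ, ∫⁻ x, min (g x) k ∂μ := by
    rw [← lintegral_iSup (fun k => hgm.min measurable_const)
      (fun i j hij x => min_le_min_left _ (by exact_mod_cast hij))]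
    refine lintegral_congr fun x => le_antisymm ?_ (iSup_le fun k => min_le_left _ _)
    refine le_of_forall_lt fun c hc => ?_
    obtain ⟨k, hk⟩ := ENNReal.exists_nat_gt (hc.ne_top)
    exact (lt_min hc hk).trans_le (le_iSup (fun k : ℕ => min (g x) (k : ℝ≥0∞)) k)
  rw [hsup]
  refine iSup_le fun k => ?_
  calc ∫⁻ x, min (g x) k ∂μ
      = ∫⁻ t in Ioi (0 : ℝ), μ {x | t < (min (g x) k).toReal} := hlayer k μ
    _ ≤ ∫⁻ t in Ioi (0 : ℝ), liminf (fun n => u n {x | t < (min (g x) k).toReal}) atTop := by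
        refine setLIntegral_mono' measurableSet_Ioi fun t ht => measure_open_le_liminf hu ?_
        have : {x | t < (min (g x) k).toReal}
            = if t < k then {x | ENNReal.ofReal t < g x} else ∅ := by
          ext x
          have hfin : min (g x) k ≠ ⊤ :=
            ((min_le_right _ _).trans_lt (ENNReal.natCast_lt_top k)).ne
          rw [mem_ofPred_eq, ← ENNReal.ofReal_lt_iff_lt_toReal (le_of_lt ht) hfin, lt_min_iff]
          have hk : ENNReal.ofReal t < k ↔ t < k := by
            rw [← ENNReal.ofReal_natCast, ENNReal.ofReal_lt_ofReal_iff_of_nonneg (le_of_lt ht)]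
          rw [hk]
          split_ifs with h <;> simp [h]
        rw [this]
        split_ifs
        · exact hg.isOpen_preimage _
        · exact isOpen_empty
    _ ≤ liminf (fun n => ∫⁻ t in Ioi (0 : ℝ), u n {x | t < (min (g x) k).toReal}) atTop :=
        lintegral_liminf_le fun n => Antitone.measurable fun s t hst =>
          measure_mono fun x hx => lt_of_le_of_lt hst hx
    _ ≤ liminf (fun n => ∫⁻ x, g x ∂(u n)) atTop := by
        refine liminf_le_liminf (Eventually.of_forall fun n => ?_)
        rw [← hlayer k (u n)]
        exact lintegral_mono fun x => min_le_left _ _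

end Vague

section Approximation

variable [SecondCountableTopology X] {κ : X → X → ℝ≥0∞}
  (hk : IsKernel κ) (hE : EnergyPrinciple κ)

/-! ### Approximation of continuous functions by potentials -/

lemma pot_toReal_integral (a t : cone hk hE) :
    Integrable (fun x => (pot κ a x).toReal) (t : Measure X) ∧
      ∫ x, (pot κ a x).toReal ∂(t : Measure X) = form hk hE t a := by
  have := sigmaFinite_of_mem a.2
  have hm : AEMeasurable (pot κ (a : Measure X)) (t : Measure X) := hk.measurable_pot.aemeasurable
  have hfin := (energy_lt_top hE t.2 a.2).ne
  refine ⟨integrable_toReal_of_lintegral_ne_top hm hfin, ?_⟩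
  exact integral_toReal hm (ae_lt_top' hm hfin)

lemma integral_spot (p m t : cone hk hE) :
    Integrable (spot κ p m) (t : Measure X) ∧
      ∫ x, spot κ p m x ∂(t : Measure X) = form hk hE t p - form hk hE t m := by
  obtain ⟨h1, h2⟩ := pot_toReal_integral hk hE p t
  obtain ⟨h3, h4⟩ := pot_toReal_integral hk hE m t
  exact ⟨h1.sub h3, by rw [← h2, ← h4, ← integral_sub h1 h3]; rfl⟩

include hk in
lemma measure_real_le_form {K : Set X} (hK : MeasurableSet K) {a : cone hk hE}
    (ha : ∀ x ∈ K, 1 ≤ pot κ a x) (t : cone hk hE) :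
    (t : Measure X).real K ≤ form hk hE t a := by
  refine ENNReal.toReal_mono (energy_lt_top hE t.2 a.2).ne ?_
  rw [← lintegral_indicator_one hK]
  refine lintegral_mono fun x => ?_
  by_cases hx : x ∈ K
  · simpa [hx] using ha x hx
  · simp [hx]

lemma exists_one_le_pot (hA2 : A2 κ) {K : Set X} (hK : IsCompact K) :
    ∃ a : cone hk hE, ∀ x ∈ K, 1 ≤ pot κ a x := by
  obtain ⟨f, hf1, -, hfc, -⟩ := exists_continuous_one_zero_of_isCompact hK isClosed_empty
    (disjoint_empty K)
  obtain ⟨-, lp, lm, -, -, hmem, -, -, -, hlim⟩ := hA2 f f.continuous hfc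
  obtain ⟨j, hj⟩ := (Metric.tendstoUniformly_iff.1 hlim (1 / 2) (by norm_num)).exists
  refine ⟨(2 : ℝ≥0) • ⟨lp j, (hmem j).1⟩, fun x hx => ?_⟩
  rw [Submodule.coe_smul, pot_smul]
  have h1 := hj x
  rw [hf1 hx, Pi.one_apply, Real.dist_eq, abs_lt] at h1
  have h2 : 1 / 2 ≤ (pot κ (lp j) x).toReal := by
    have : 0 ≤ (pot κ (lm j) x).toReal := ENNReal.toReal_nonneg
    simp only [spot] at h1
    linarith [h1.2]
  have h3 := ENNReal.ofReal_le_of_le_toReal h2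
  calc (1 : ℝ≥0∞) = 2 * ENNReal.ofReal (1 / 2) := by
        rw [← ENNReal.ofReal_ofNat, ← ENNReal.ofReal_mul (by norm_num)]; norm_num
    _ ≤ _ := by gcongr; simp

lemma exists_approx (hA2 : A2 κ) {f : X → ℝ} (hf : Continuous f) (hfc : HasCompactSupport f) :
    ∃ a : cone hk hE, ∀ ε : ℝ, 0 < ε → ∃ p m : cone hk hE,
      (∀ x, |spot κ p m x - f x| ≤ ε) ∧
      ∀ t : cone hk hE, |form hk hE t p - form hk hE t m - ∫ x, f x ∂(t : Measure X)|
        ≤ ε * form hk hE t a := by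
  obtain ⟨K, lp, lm, hK, hfK, hmem, -, -, hsupp, hlim⟩ := hA2 f hf hfc
  obtain ⟨a, ha⟩ := exists_one_le_pot hk hE hA2 hK
  refine ⟨a, fun ε hε => ?_⟩
  obtain ⟨j, hj⟩ := (Metric.tendstoUniformly_iff.1 hlim ε hε).exists
  have hj' : ∀ x, |spot κ (lp j) (lm j) x - f x| ≤ ε := by
    intro x
    have := hj x
    rw [dist_comm, Real.dist_eq] at this
    exact this.le
  refine ⟨⟨lp j, (hmem j).1⟩, ⟨lm j, (hmem j).2⟩, hj', fun t => ?_⟩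
  obtain ⟨h1, h2⟩ := integral_spot hk hE ⟨lp j, (hmem j).1⟩ ⟨lm j, (hmem j).2⟩ t
  have := t.2.1.2
  have h3 : Integrable f (t : Measure X) := hf.integrable_of_hasCompactSupport hfc
  rw [← h2, ← integral_sub h1 h3, ← setIntegral_eq_integral_of_forall_compl_eq_zero (s := K)]
  · have h4 := norm_setIntegral_le_of_norm_le_const (C := ε)
      (f := fun x => spot κ (lp j) (lm j) x - f x) (hK.measure_lt_top (μ := (t : Measure X)))
      fun x _ => hj' x
    refine h4.trans ?_
    exact mul_le_mul_of_nonneg_left (measure_real_le_form hk hE hK.measurableSet ha t) hε.le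
  · intro x hx
    have e1 : f x = 0 := image_eq_zero_of_notMem_tsupport fun h => hx (hfK h)
    have e2 : spot κ (lp j) (lm j) x = 0 :=
      image_eq_zero_of_notMem_tsupport fun h => hx (hsupp j h)
    simp [e1, e2]

end Approximation

section Completeness

variable [SecondCountableTopology X] {κ : X → X → ℝ≥0∞}
  (hk : IsKernel κ) (hE : EnergyPrinciple κ)

/-! ### Strong completeness of the cone of measures of finite energy -/

lemma cauchySeq_integral (hA2 : A2 κ) {u : ℕ → cone hk hE}
    (hu : StrongCauchySeq (form hk hE) u) {f : X → ℝ} (hf : Continuous f)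
    (hfc : HasCompactSupport f) : CauchySeq fun n => ∫ x, f x ∂(u n : Measure X) := by
  have hG := isGram_form hk hE
  obtain ⟨a, ha⟩ := exists_approx hk hE hA2 hf hfc
  obtain ⟨C, N₀, hC⟩ := hG.bounded_of_cauchy hu
  set R := C + form hk hE a a with hR
  have hR0 : 0 ≤ R := add_nonneg ((hG.nonneg _ _).trans (hC N₀ le_rfl)) (hG.nonneg _ _)
  have hb : ∀ n ≥ N₀, form hk hE (u n) a ≤ R := fun n hn => by
    have h1 := hG.two_mul_le (u n) a
    have h2 := hC n hn
    linarith [hG.nonneg (u n) a]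
  refine Metric.cauchySeq_iff.2 fun ε hε => ?_
  obtain ⟨p, m, -, hpm⟩ := ha (ε / (4 * (R + 1))) (by positivity)
  have hsmall : ∀ n ≥ N₀, ε / (4 * (R + 1)) * form hk hE (u n) a ≤ ε / 4 := fun n hn => by
    calc ε / (4 * (R + 1)) * form hk hE (u n) a ≤ ε / (4 * (R + 1)) * (R + 1) := by
          gcongr; linarith [hb n hn]
      _ = ε / 4 := by field_simp
  obtain ⟨N₁, hN₁⟩ := Metric.cauchySeq_iff.1 (hG.cauchySeq_left hu p) (ε / 4) (by positivity)
  obtain ⟨N₂, hN₂⟩ := Metric.cauchySeq_iff.1 (hG.cauchySeq_left hu m) (ε / 4) (by positivity)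
  refine ⟨max N₀ (max N₁ N₂), fun i hi j hj => ?_⟩
  simp only [ge_iff_le, max_le_iff] at hi hj
  have h1 := (hpm (u i)).trans (hsmall i hi.1)
  have h2 := (hpm (u j)).trans (hsmall j hj.1)
  have h3 := hN₁ i hi.2.1 j hj.2.1
  have h4 := hN₂ i hi.2.2 j hj.2.2
  rw [hG.symm (u i) p, hG.symm (u i) m] at h1
  rw [hG.symm (u j) p, hG.symm (u j) m] at h2
  rw [Real.dist_eq, abs_lt] at h3 h4 ⊢
  rw [abs_le] at h1 h2
  constructor <;> linarith [h1.1, h1.2, h2.1, h2.2, h3.1, h3.2, h4.1, h4.2]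

lemma exists_vague_limit {u : ℕ → Measure X} [∀ n, IsLocallyFiniteMeasure (u n)]
    (hu : ∀ f : X → ℝ, Continuous f → HasCompactSupport f →
      CauchySeq fun n => ∫ x, f x ∂(u n)) :
    ∃ μ : Measure X, μ.Regular ∧ VagueConv atTop u μ := by
  have hlim : ∀ f : C_c(X, ℝ), ∃ l, Tendsto (fun n => ∫ x, f x ∂(u n)) atTop (𝓝 l) := fun f =>
    cauchySeq_tendsto_of_complete (hu f f.continuous f.hasCompactSupport)
  choose L hL using hlim
  let Λ : C_c(X, ℝ) →ₚ[ℝ] ℝ := PositiveLinearMap.mk₀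
    { toFun := L
      map_add' := fun f g => tendsto_nhds_unique (hL (f + g)) <|
        ((hL f).add (hL g)).congr fun n => (integral_add f.integrable g.integrable).symm
      map_smul' := fun c f => tendsto_nhds_unique (hL (c • f)) <|
        ((hL f).const_smul c).congr fun n => (integral_smul c f).symm }
    fun f hf => ge_of_tendsto' (hL f) fun n => integral_nonneg hf
  refine ⟨RealRMK.rieszMeasure Λ, inferInstance, fun f hf hfc => ?_⟩
  have := RealRMK.integral_rieszMeasure Λ ⟨⟨f, hf⟩, hfc⟩
  exact this ▸ hL ⟨⟨f, hf⟩, hfc⟩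

lemma exists_strongLim_vague (hC : Consistent κ) (hA2 : A2 κ) {u : ℕ → cone hk hE}
    (hu : StrongCauchySeq (form hk hE) u) :
    ∃ a : cone hk hE, StrongLim (form hk hE) u a ∧
      VagueConv atTop (fun n => (u n : Measure X)) a := by
  have hG := isGram_form hk hE
  have : ∀ n, IsLocallyFiniteMeasure (u n : Measure X) := fun n => (u n).2.1.2
  obtain ⟨μ, hreg, hμ⟩ := exists_vague_limit (u := fun n => (u n : Measure X))
    fun f hf hfc => cauchySeq_integral hk hE hA2 hu hf hfc
  obtain ⟨C, N, hCN⟩ := hG.bounded_of_cauchy hu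
  have hC0 : 0 ≤ C := (hG.nonneg _ _).trans (hCN N le_rfl)
  have hb : ∀ m ≥ N, ∀ n ≥ N, energy κ (u m) (u n) ≤ ENNReal.ofReal C := fun m hm n hn => by
    rw [← ofReal_form]
    refine ENNReal.ofReal_le_ofReal ?_
    linarith [hG.two_mul_le (u m) (u n), hCN m hm, hCN n hn]
  have hsf : SigmaFinite μ := inferInstance
  have h1 : ∀ m ≥ N, energy κ μ (u m) ≤ ENNReal.ofReal C := fun m hm =>
    (lintegral_le_liminf hμ hk.lowerSemicontinuous_pot).trans <|
      liminf_le_of_frequently_le' (((eventually_ge_atTop N).mono fun n hn =>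
        hb n hn m hm).frequently)
  have h2 : energy κ μ μ ≤ ENNReal.ofReal C := by
    refine (lintegral_le_liminf hμ hk.lowerSemicontinuous_pot).trans <|
      liminf_le_of_frequently_le' (((eventually_ge_atTop N).mono fun n hn => ?_).frequently)
    have := sigmaFinite_of_mem (u n).2
    exact (hk.energy_comm (μ := (u n : Measure X)) (ν := μ)).trans_le (h1 n hn)
  have hmem : μ ∈ Eplus κ :=
    ⟨isRadon_iff.2 inferInstance, h2.trans_lt ENNReal.ofReal_lt_top⟩
  refine ⟨⟨μ, hmem⟩, ?_, hμ⟩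
  have hcau : StrongCauchy κ atTop fun n => (u n : Measure X) := fun ε hε => by
    obtain ⟨N, hN⟩ := hu (ε ^ 2) (by positivity)
    refine ⟨Ici N, Ici_mem_atTop N, fun i hi j hj => ?_⟩
    rw [strDist_eq hk hE, Real.sqrt_lt' hε]
    exact hN i hi j hj
  have h3 := hC ℕ atTop (fun n => (u n : Measure X)) inferInstance (fun n => (u n).2) hcau μ
    ⟨atTop, le_rfl, inferInstance, hμ⟩
  have h4 := h3.pow 2
  rw [zero_pow two_ne_zero] at h4
  refine h4.congr fun n => ?_
  rw [strDist_eq hk hE (u n) ⟨μ, hmem⟩, Real.sq_sqrt (hG.sqDist_nonneg _ _)]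

lemma strongComplete (hC : Consistent κ) (hA2 : A2 κ) : StrongComplete (form hk hE) :=
  fun _ hu => (exists_strongLim_vague hk hE hC hA2 hu).imp fun _ h => h.1

lemma strongLim_unique {u : ℕ → cone hk hE} {a b : cone hk hE}
    (ha : StrongLim (form hk hE) u a) (hb : StrongLim (form hk hE) u b) : a = b := by
  have hG := isGram_form hk hE
  refine eq_of_sqDist_eq_zero hk hE ?_
  rw [hG.sqDist_comm]
  exact tendsto_nhds_unique (hG.tendsto_sqDist hb a) ha |>.symm ▸ rfl

lemma vagueConv_of_strongLim (hC : Consistent κ) (hA2 : A2 κ) {u : ℕ → cone hk hE}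
    {a : cone hk hE} (ha : StrongLim (form hk hE) u a) :
    VagueConv atTop (fun n => (u n : Measure X)) a := by
  obtain ⟨b, hb, hv⟩ := exists_strongLim_vague hk hE hC hA2 ((isGram_form hk hE).cauchy_of_lim ha)
  rwa [strongLim_unique hk hE ha hb]

end Completeness

section Null

variable [SecondCountableTopology X] {κ : X → X → ℝ≥0∞}
  (hk : IsKernel κ) (hE : EnergyPrinciple κ)

/-! ### Sets of inner capacity zero -/

/-- The compact subsets of `S` are null for all measures of finite energy. -/
def EnergyNull (κ : X → X → ℝ≥0∞) (S : Set X) : Prop :=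
  ∀ K ⊆ S, IsCompact K → ∀ τ ∈ Eplus κ, τ K = 0

lemma EnergyNull.mono {S T : Set X} (h : EnergyNull κ T) (hST : S ⊆ T) : EnergyNull κ S :=
  fun K hK => h K (hK.trans hST)

lemma measure_eq_zero_of_compacts {τ : Measure X} (hτ : τ ∈ Eplus κ) {S : Set X}
    (hS : MeasurableSet S) (h : ∀ K ⊆ S, IsCompact K → τ K = 0) : τ S = 0 := by
  have := hτ.1.1
  rw [hS.measure_eq_iSup_isCompact]
  simpa using h

lemma ConcOn.measure_compl {μ : Measure X} {S : Set X} (h : ConcOn μ S) : μ Sᶜ = 0 := by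
  rw [← inter_univ Sᶜ, ← iUnion_compactCovering X, inter_iUnion]
  exact measure_iUnion_null fun n => h.2 _ (isCompact_compactCovering X n)

lemma ConcOn.mono {μ : Measure X} {S T : Set X} (h : ConcOn μ S) (hST : S ⊆ T) : ConcOn μ T := by
  have h0 : μ Tᶜ = 0 := measure_mono_null (compl_subset_compl.2 hST) h.measure_compl
  exact ⟨(NullMeasurableSet.of_null h0).of_compl, fun K _ => measure_mono_null inter_subset_left h0⟩

lemma innerCap_mono {S T : Set X} (hST : S ⊆ T) : innerCap κ S ≤ innerCap κ T :=
  ENNReal.inv_le_inv' <| biInf_mono fun _ h => ⟨⟨h.1.1, h.1.2.mono hST⟩, h.2⟩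

lemma innerCap_le_outerCap (S : Set X) : innerCap κ S ≤ outerCap κ S :=
  le_iInf₂ fun _ h => innerCap_mono h.2

lemma OuterLam_subset_InnerLam (A : Set X) (μ : Measure X) : OuterLam κ A μ ⊆ InnerLam κ A μ :=
  fun _ h => ⟨h.1, le_antisymm ((innerCap_le_outerCap _).trans h.2.le) zero_le⟩

include hk hE in
lemma innerCap_eq_zero_iff {S : Set X} : innerCap κ S = 0 ↔ EnergyNull κ S := by
  rw [innerCap, ENNReal.inv_eq_zero]
  simp only [iInf_eq_top]
  constructor
  · intro h K hKS hK τ hτ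
    by_contra hne
    have := hτ.1.2
    have hfin : τ K ≠ ⊤ := hK.measure_lt_top.ne
    set σ : Measure X := (τ K).toNNReal⁻¹ • τ.restrict K with hσ
    have hmem : σ ∈ Eplus κ := (cone hk hE).smul_mem _ (restrict_mem hτ K)
    have h0 : σ Kᶜ = 0 := by
      rw [hσ, Measure.smul_apply, Measure.restrict_apply hK.measurableSet.compl]
      simp
    have h1 : σ univ = 1 := by
      rw [hσ, Measure.smul_apply, Measure.restrict_apply_univ, ENNReal.smul_def, smul_eq_mul,
        ENNReal.coe_inv (ENNReal.toNNReal_ne_zero.2 ⟨hne, hfin⟩), ENNReal.coe_toNNReal hfin,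
        ENNReal.inv_mul_cancel hne hfin]
    refine hmem.2.ne (h σ ⟨⟨hmem, ?_, fun C _ => ?_⟩, h1⟩)
    · refine NullMeasurableSet.of_compl (NullMeasurableSet.of_null (measure_mono_null ?_ h0))
      exact compl_subset_compl.2 hKS
    · exact measure_mono_null (inter_subset_left.trans (compl_subset_compl.2 hKS)) h0
  · rintro h σ ⟨⟨hσ, hconc⟩, h1⟩
    exfalso
    have hc := hconc.measure_compl
    obtain ⟨T, hTS, hT, hTe⟩ := hconc.1.exists_measurable_subset_ae_eq
    have h2 : σ T = 0 := measure_eq_zero_of_compacts hσ hT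
      fun K hKT hK => h K (hKT.trans hTS) hK σ hσ
    rw [measure_congr hTe] at h2
    have h3 : σ univ ≤ σ S + σ Sᶜ := by rw [← union_compl_self S]; exact measure_union_le _ _
    rw [h1, h2, hc] at h3
    simp at h3

/-- The cone of measures of finite energy carried by compact subsets of `A`. -/
def carried (A : Set X) : Submodule ℝ≥0 (cone hk hE) where
  carrier := {t | ∃ K ⊆ A, IsCompact K ∧ (t : Measure X) Kᶜ = 0}
  zero_mem' := ⟨∅, empty_subset A, isCompact_empty, by simp⟩
  add_mem' := by
    rintro s t ⟨K, hKA, hK, hs⟩ ⟨L, hLA, hL, ht⟩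
    refine ⟨K ∪ L, union_subset hKA hLA, hK.union hL, ?_⟩
    rw [Submodule.coe_add, Measure.add_apply, compl_union, measure_mono_null inter_subset_left hs,
      measure_mono_null inter_subset_right ht, add_zero]
  smul_mem' := by
    rintro c t ⟨K, hKA, hK, ht⟩
    exact ⟨K, hKA, hK, by rw [Submodule.coe_smul, Measure.smul_apply, ht, smul_zero]⟩

lemma carried_mono {A B : Set X} (h : A ⊆ B) : carried hk hE A ≤ carried hk hE B :=
  fun _ ⟨K, hK, ht⟩ => ⟨K, hK.trans h, ht⟩

/-- The restriction of a measure of finite energy. -/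
noncomputable def restr (t : cone hk hE) (S : Set X) : cone hk hE :=
  ⟨(t : Measure X).restrict S, restrict_mem t.2 S⟩

lemma restr_mem_carried {A : Set X} {t : cone hk hE} (ht : t ∈ carried hk hE A) (S : Set X) :
    restr hk hE t S ∈ carried hk hE A := by
  obtain ⟨K, hKA, hK, h0⟩ := ht
  exact ⟨K, hKA, hK, le_antisymm ((Measure.restrict_le_self _).trans h0.le) zero_le⟩

lemma ae_pot_le_of_carried {A : Set X} {a c : cone hk hE}
    (h : ∀ t ∈ carried hk hE A, form hk hE t a ≤ form hk hE t c) {t : cone hk hE}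
    (ht : t ∈ carried hk hE A) : ∀ᵐ x ∂(t : Measure X), pot κ a x ≤ pot κ c x :=
  ae_pot_le hk hE a.2 c.2 t.2 ((form_le_iff hk hE (restr hk hE t _) a (restr hk hE t _) c).1
    (h _ (restr_mem_carried hk hE ht _)))

lemma energyNull_iff {A : Set X} {a c : cone hk hE} :
    EnergyNull κ {x | x ∈ A ∧ ¬ pot κ a x ≤ pot κ c x} ↔
      ∀ t ∈ carried hk hE A, form hk hE t a ≤ form hk hE t c := by
  have := sigmaFinite_of_mem a.2
  have := sigmaFinite_of_mem c.2
  constructor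
  · rintro h t ⟨K, hKA, hK, h0⟩
    rw [form_le_iff]
    refine lintegral_mono_ae ?_
    rw [ae_iff]
    have hm : MeasurableSet {x | ¬ pot κ a x ≤ pot κ c x} :=
      (measurableSet_le hk.measurable_pot hk.measurable_pot).compl
    have h1 : (t : Measure X) ({x | ¬ pot κ a x ≤ pot κ c x} ∩ K) = 0 :=
      measure_eq_zero_of_compacts t.2 (hm.inter hK.measurableSet) fun C hC hC' =>
        h C (fun x hx => ⟨hKA (hC hx).2, (hC hx).1⟩) hC' t t.2
    refine measure_mono_null (t := ({x | ¬ pot κ a x ≤ pot κ c x} ∩ K) ∪ Kᶜ) (fun x hx => ?_)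
      (measure_union_null h1 h0)
    by_cases hxK : x ∈ K
    · exact Or.inl ⟨hx, hxK⟩
    · exact Or.inr hxK
  · intro h K hKA hK τ hτ
    have hmem : restr hk hE ⟨τ, hτ⟩ K ∈ carried hk hE A :=
      ⟨K, fun x hx => (hKA hx).1, hK, by
        simp [restr, Measure.restrict_apply hK.measurableSet.compl]⟩
    have h1 := ae_pot_le_of_carried hk hE h hmem
    have h2 := (ae_restrict_iff' hK.measurableSet).1 h1
    refine measure_mono_null (fun x hx => ?_) (ae_iff.1 h2)
    exact fun h => (hKA hx).2 (h hx)

lemma mem_InnerLam_iff {A : Set X} {a c : cone hk hE} : (c : Measure X) ∈ InnerLam κ A a ↔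
    ∀ t ∈ carried hk hE A, form hk hE t a ≤ form hk hE t c := by
  rw [← energyNull_iff, ← innerCap_eq_zero_iff hk hE]
  exact ⟨fun h => h.2, fun h => ⟨c.2, h⟩⟩

end Null

section Projection

variable [SecondCountableTopology X] {κ : X → X → ℝ≥0∞}
  {hk : IsKernel κ} {hE : EnergyPrinciple κ}

/-! ### Inner balayage as a projection -/

/-- `b` is the projection of `a` on the strong closure of the measures carried by compact
subsets of `A`. -/
structure IsProj (hk : IsKernel κ) (hE : EnergyPrinciple κ) (A : Set X) (a b : cone hk hE) :
    Prop where
  approx : ∃ u, (∀ n, u n ∈ carried hk hE A) ∧ StrongLim (form hk hE) u b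
  le : ∀ t ∈ carried hk hE A, form hk hE a t ≤ form hk hE b t
  eq : form hk hE b b = form hk hE a b

lemma exists_isProj (hC : Consistent κ) (hA2 : A2 κ) (A : Set X) (a : cone hk hE) :
    ∃ b, IsProj hk hE A a b := by
  have hG := isGram_form hk hE
  obtain ⟨b, h1, h2, h3⟩ := hG.exists_maximizer (strongComplete hk hE hC hA2) (carried hk hE A)
    (form hk hE a) (C := form hk hE a a) (fun t _ => by linarith [hG.two_mul_le a t])
    fun u b hu => hG.tendsto_left hu a
  exact ⟨b, h1, h2, h3⟩

namespace IsProj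

variable {A : Set X} {a b : cone hk hE}

lemma mono_of_approx (h : IsProj hk hE A a b) {Q : Set X} (hQ : Q ⊆ A) {u : ℕ → cone hk hE}
    (hu : ∀ n, u n ∈ carried hk hE Q) (hub : StrongLim (form hk hE) u b) : IsProj hk hE Q a b :=
  ⟨⟨u, hu, hub⟩, fun t ht => h.le t (carried_mono hk hE hQ ht), h.eq⟩

lemma sqDist_le (h : IsProj hk hE A a b) {t : cone hk hE} (ht : t ∈ carried hk hE A) :
    sqDist (form hk hE) t b ≤ sqDist (form hk hE) t a - sqDist (form hk hE) b a := by
  have hG := isGram_form hk hE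
  have h1 := h.le t ht
  simp only [sqDist, hG.symm t b, hG.symm t a, hG.symm b a, h.eq] at h1 ⊢
  linarith

lemma mem_carried_of_isCompact (hC : Consistent κ) (hA2 : A2 κ) {K : Set X} (hK : IsCompact K)
    (h : IsProj hk hE K a b) : b ∈ carried hk hE K := by
  obtain ⟨u, hu, hub⟩ := h.approx
  have := fun n => (u n).2.1.2
  have := regular_of_mem b.2
  refine ⟨K, subset_rfl, hK, le_antisymm ?_ zero_le⟩
  refine (measure_open_le_liminf (vagueConv_of_strongLim hk hE hC hA2 hub)
    hK.isClosed.isOpen_compl).trans ?_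
  have h0 : ∀ n, (u n : Measure X) Kᶜ = 0 := fun n => by
    obtain ⟨L, hL, -, h⟩ := hu n
    exact measure_mono_null (compl_subset_compl.2 hL) h
  simp [h0]

lemma form_le_of_isCompact (hC : Consistent κ) (hA2 : A2 κ) (hD : Domination κ) {K : Set X}
    (hK : IsCompact K) (h : IsProj hk hE K a b) {c : cone hk hE}
    (hc : ∀ t ∈ carried hk hE K, form hk hE t a ≤ form hk hE t c) (t : cone hk hE) :
    form hk hE t b ≤ form hk hE t c := by
  have hG := isGram_form hk hE
  have := sigmaFinite_of_mem a.2
  have := sigmaFinite_of_mem b.2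
  have hbK := h.mem_carried_of_isCompact hC hA2 hK
  have h1 : ∀ᵐ x ∂(b : Measure X), pot κ a x ≤ pot κ b x :=
    ae_pot_le_of_carried hk hE (fun t ht => by rw [hG.symm t a, hG.symm t b]; exact h.le t ht) hbK
  have h2 := ae_pot_le_of_carried hk hE hc hbK
  have h3 : energy κ b b = energy κ b a := by
    rw [← ofReal_form, ← ofReal_form, h.eq, hG.symm]
  have h4 : pot κ (a : Measure X) =ᵐ[(b : Measure X)] pot κ b :=
    ae_eq_of_ae_le_of_lintegral_le h1 (energy_lt_top hE b.2 a.2).ne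
      hk.measurable_pot.aemeasurable h3.le
  refine (pot_le_iff_form_le hk hE hD b c).1 (hD b b.2 c c.2 ?_) t
  filter_upwards [h2, h4] with x hx hx'
  rwa [← hx']

lemma form_le (hC : Consistent κ) (hA2 : A2 κ) (hD : Domination κ) (h : IsProj hk hE A a b)
    {c : cone hk hE} (hc : ∀ t ∈ carried hk hE A, form hk hE t a ≤ form hk hE t c)
    (t : cone hk hE) : form hk hE t b ≤ form hk hE t c := by
  have hG := isGram_form hk hE
  obtain ⟨u, hu, hub⟩ := h.approx
  choose K hKA hK hKu using hu
  choose v hv using fun n => exists_isProj hC hA2 (K n) a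
  have hvK := fun n => (hv n).mem_carried_of_isCompact hC hA2 (hK n)
  have hlim : StrongLim (form hk hE) v b := by
    have h1 := (hG.tendsto_sqDist hub a).sub_const (sqDist (form hk hE) b a)
    rw [sub_self] at h1
    refine squeeze_zero (fun n => hG.sqDist_nonneg _ _) (fun n => ?_) h1
    have h2 := h.sqDist_le (carried_mono hk hE (hKA n) (hvK n))
    have h3 := (hv n).sqDist_le ⟨K n, subset_rfl, hK n, hKu n⟩
    have h4 := hG.sqDist_nonneg (u n) (v n)
    linarith
  exact le_of_tendsto' (hG.tendsto_left hlim t) fun n =>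
    (hv n).form_le_of_isCompact hC hA2 hD (hK n)
      (fun t ht => hc t (carried_mono hk hE (hKA n) ht)) t

lemma isInnerBal (hC : Consistent κ) (hA2 : A2 κ) (hD : Domination κ) (h : IsProj hk hE A a b) :
    IsInnerBal κ A a b := by
  have hG := isGram_form hk hE
  refine ⟨(mem_InnerLam_iff hk hE).2 fun t ht => ?_, fun ν hν => ?_⟩
  · rw [hG.symm t a, hG.symm t b]
    exact h.le t ht
  · exact (pot_le_iff_form_le hk hE hD b ⟨ν, hν.1⟩).2
      (h.form_le hC hA2 hD ((mem_InnerLam_iff hk hE).1 hν))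

lemma form_eq (hC : Consistent κ) (hA2 : A2 κ) (hD : Domination κ) (h : IsProj hk hE A a b)
    {c d : cone hk hE} (h' : IsProj hk hE A c d) : form hk hE c b = form hk hE d b := by
  have hG := isGram_form hk hE
  obtain ⟨u, hu, hub⟩ := h.approx
  refine le_antisymm (le_of_tendsto_of_tendsto' (hG.tendsto_left hub c) (hG.tendsto_left hub d)
    fun n => h'.le _ (hu n)) ?_
  rw [hG.symm d b, hG.symm c b]
  exact h'.form_le hC hA2 hD (fun _ _ => le_rfl) b

/-- Balayage is symmetric. -/
lemma form_comm (hC : Consistent κ) (hA2 : A2 κ) (hD : Domination κ) (h : IsProj hk hE A a b)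
    {c d : cone hk hE} (h' : IsProj hk hE A c d) : form hk hE c b = form hk hE d a := by
  have hG := isGram_form hk hE
  rw [h.form_eq hC hA2 hD h', hG.symm d b, hG.symm d a, h'.form_eq hC hA2 hD h]

end IsProj

end Projection

section Separating

variable [SecondCountableTopology X] {κ : X → X → ℝ≥0∞}

/-! ### Countable separating families -/

lemma continuous_setIntegral_continuousMap (μ : Measure X) [IsLocallyFiniteMeasure μ] {K : Set X}
    (hK : IsCompact K) : Continuous fun f : C(X, ℝ) => ∫ x in K, f x ∂μ := by
  refine continuous_iff_continuousAt.2 fun f => Metric.tendsto_nhds.2 fun ε hε => ?_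
  have h1 := Metric.tendstoUniformlyOn_iff.1
    (ContinuousMap.tendsto_iff_forall_isCompact_tendstoUniformlyOn.1
      (tendsto_id (x := 𝓝 f)) K hK) (ε / (μ.real K + 1)) (by positivity)
  filter_upwards [h1] with g hg
  have hi : ∀ h : C(X, ℝ), IntegrableOn h K μ := fun h =>
    h.continuous.continuousOn.integrableOn_compact hK
  rw [Real.dist_eq, ← integral_sub (hi g) (hi f)]
  have h2 := norm_setIntegral_le_of_norm_le_const (C := ε / (μ.real K + 1))
    (f := fun x => g x - f x) (hK.measure_lt_top (μ := μ)) fun x hx => by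
      have := (hg x hx).le
      rwa [dist_comm] at this
  refine lt_of_le_of_lt h2 ?_
  rw [div_mul_eq_mul_div, div_lt_iff₀ (by positivity)]
  linarith

lemma exists_countable_determining : ∃ f : ℕ × ℕ → C(X, ℝ), (∀ i, HasCompactSupport (f i)) ∧
    ∀ μ ν : Measure X, μ.Regular → ν.Regular →
      (∀ i, ∫ x, f i x ∂μ = ∫ x, f i x ∂ν) → μ = ν := by
  let K : CompactExhaustion X := default
  let S : ℕ → Set C(X, ℝ) := fun n => {f | tsupport f ⊆ K n}
  have hne : ∀ n, Nonempty (S n) := fun n => ⟨0, by simp [S, tsupport]⟩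
  have hS : ∀ n (f : S n) (μ : Measure X),
      ∫ x in K n, (f : C(X, ℝ)) x ∂μ = ∫ x, (f : C(X, ℝ)) x ∂μ := fun n f μ =>
    setIntegral_eq_integral_of_forall_compl_eq_zero fun x hx =>
      image_eq_zero_of_notMem_tsupport fun h => hx (f.2 h)
  refine ⟨fun i => TopologicalSpace.denseSeq (S i.1) i.2, fun i => ?_, fun μ ν hμ hν h => ?_⟩
  · exact (K.isCompact i.1).of_isClosed_subset (isClosed_tsupport _)
      (TopologicalSpace.denseSeq (S i.1) i.2).2
  · refine Measure.ext_of_integral_eq_on_compactlySupported fun f => ?_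
    obtain ⟨n, hn⟩ := K.exists_superset_of_isCompact f.hasCompactSupport
    have hcont : ∀ (μ : Measure X) [IsLocallyFiniteMeasure μ],
        Continuous fun g : S n => ∫ x in K n, (g : C(X, ℝ)) x ∂μ := fun μ _ =>
      (continuous_setIntegral_continuousMap μ (K.isCompact n)).comp continuous_subtype_val
    have h1 : (fun g : S n => ∫ x in K n, (g : C(X, ℝ)) x ∂μ)
        = fun g : S n => ∫ x in K n, (g : C(X, ℝ)) x ∂ν := by
      refine (hcont μ).ext_on (TopologicalSpace.denseRange_denseSeq (S n)) (hcont ν) ?_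
      rintro _ ⟨k, rfl⟩
      simpa only [hS] using h (n, k)
    have h2 := congrFun h1 ⟨f.toContinuousMap, hn⟩
    have h3 := hS n ⟨f.toContinuousMap, hn⟩
    exact ((h3 μ).symm.trans h2).trans (h3 ν)

lemma exists_countable_separating (hk : IsKernel κ) (hE : EnergyPrinciple κ) (hA2 : A2 κ) :
    ∃ l : (ℕ × ℕ) × ℕ × Bool → cone hk hE, ∀ s t : cone hk hE,
      (∀ i, form hk hE (l i) s = form hk hE (l i) t) → s = t := by
  have hG := isGram_form hk hE
  obtain ⟨f, hfc, hf⟩ := exists_countable_determining (X := X)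
  choose a ha using fun i => exists_approx hk hE hA2 (f i).continuous (hfc i)
  choose p m _ hpm using fun i (n : ℕ) => ha i (1 / ((n : ℝ) + 1)) Nat.one_div_pos_of_nat
  refine ⟨fun i => if i.2.2 then p i.1 i.2.1 else m i.1 i.2.1, fun s t h => ?_⟩
  have hlim : ∀ i (t : cone hk hE), Tendsto (fun n => form hk hE t (p i n) - form hk hE t (m i n))
      atTop (𝓝 (∫ x, f i x ∂(t : Measure X))) := fun i t => by
    rw [tendsto_iff_dist_tendsto_zero]
    refine squeeze_zero (fun _ => dist_nonneg) (fun n => hpm i n t) ?_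
    simpa using tendsto_one_div_add_atTop_nhds_zero_nat.mul_const (form hk hE t (a i))
  refine Subtype.ext (hf s t (regular_of_mem s.2) (regular_of_mem t.2) fun i =>
    tendsto_nhds_unique (hlim i s) ((hlim i t).congr fun n => ?_))
  have h1 := h (i, n, true)
  have h2 := h (i, n, false)
  simp only [if_true, Bool.false_eq_true, if_false] at h1 h2
  rw [hG.symm s, hG.symm s, hG.symm t, hG.symm t, h1, h2]

/-- A σ-compact subset which carries all the inner balayages on `A`. -/
lemma exists_sigmaCompact_isProj (hk : IsKernel κ) (hE : EnergyPrinciple κ) (hC : Consistent κ)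
    (hD : Domination κ) (hA2 : A2 κ) (A : Set X) :
    ∃ A₀ ⊆ A, IsSigmaCompact A₀ ∧ ∀ a : cone hk hE, ∃ b, ∀ Q, A₀ ⊆ Q → Q ⊆ A →
      IsProj hk hE Q a b := by
  obtain ⟨l, hl⟩ := exists_countable_separating hk hE hA2
  choose c hc using fun i => exists_isProj hC hA2 A (l i)
  choose u hu huc using fun i => (hc i).approx
  choose K hKA hK hKu using hu
  refine ⟨⋃ i, ⋃ n, K i n, iUnion₂_subset hKA, isSigmaCompact_iUnion _ fun i =>
    isSigmaCompact_iUnion_of_isCompact _ (hK i), fun a => ?_⟩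
  obtain ⟨b, hb⟩ := exists_isProj hC hA2 A a
  refine ⟨b, fun Q h0 hQ => ?_⟩
  obtain ⟨b', hb'⟩ := exists_isProj hC hA2 Q a
  have : b = b' := hl b b' fun i => by
    have h1 : IsProj hk hE Q (l i) (c i) := (hc i).mono_of_approx hQ
      (fun n => ⟨K i n, (subset_iUnion₂ i n).trans h0, hK i n, hKu i n⟩) (huc i)
    rw [hb.form_comm hC hA2 hD (hc i), hb'.form_comm hC hA2 hD h1]
  exact this ▸ hb'

end Separating

section Capacity

variable [SecondCountableTopology X] {κ : X → X → ℝ≥0∞}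
  (hk : IsKernel κ) (hE : EnergyPrinciple κ)

/-! ### The capacity defined by dominating potentials -/

/-- `A` is dominated by potentials of energies arbitrarily close to `t`. -/
def CapLE (A : Set X) (t : ℝ) : Prop :=
  ∀ ε > 0, ∃ a : cone hk hE, (∀ x ∈ A, 1 ≤ pot κ a x) ∧ form hk hE a a < t + ε

lemma CapLE.mono {A B : Set X} {t : ℝ} (h : CapLE hk hE B t) (hAB : A ⊆ B) :
    CapLE hk hE A t := fun ε hε =>
  let ⟨a, ha, hlt⟩ := h ε hε
  ⟨a, fun x hx => ha x (hAB hx), hlt⟩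

lemma capLE_iUnion (hC : Consistent κ) (hD : Domination κ) (hA2 : A2 κ) {A : ℕ → Set X}
    (hA : Monotone A) {t : ℝ} (h : ∀ n, CapLE hk hE (A n) t) : CapLE hk hE (⋃ n, A n) t := by
  have hG := isGram_form hk hE
  have hcomp := strongComplete hk hE hC hA2
  obtain ⟨u, hu, hcau, hle⟩ := hG.exists_cauchy_minimizing
    (fun n => {a : cone hk hE | ∀ x ∈ A n, 1 ≤ pot κ a x})
    (fun m n hmn a ha x hx => ha x (hA hmn hx))
    (fun n a ha b hb x hx => by
      rw [Submodule.coe_smul, pot_smul, Submodule.coe_add, pot_add]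
      calc (1 : ℝ≥0∞) = ((2⁻¹ : ℝ≥0) : ℝ≥0∞) * (1 + 1) := by
            rw [one_add_one_eq_two, ENNReal.coe_inv two_ne_zero, ENNReal.coe_ofNat,
              ENNReal.inv_mul_cancel two_ne_zero ENNReal.ofNat_ne_top]
        _ ≤ _ := by gcongr; exacts [ha x hx, hb x hx])
    h
  obtain ⟨w, hw⟩ := hcomp u hcau
  have hwt : form hk hE w w ≤ t := by
    have h1 := (tendsto_one_div_add_atTop_nhds_zero_nat (𝕜 := ℝ)).const_add t
    rw [add_zero] at h1
    exact le_of_tendsto_of_tendsto' (hG.tendsto_self hw) h1 hle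
  intro ε hε
  set s := √(form hk hE w w) with hs
  have hs0 : 0 ≤ s := Real.sqrt_nonneg _
  have hss : s ^ 2 = form hk hE w w := Real.sq_sqrt (hG.nonneg _ _)
  set δ := min 1 (ε / (2 * s + 2)) with hδ
  have hδ0 : 0 < δ := by positivity
  have hδ1 : δ ≤ 1 := min_le_left _ _
  have hδ2 : δ * (2 * s + 2) ≤ ε := (le_div_iff₀ (by positivity)).1 (min_le_right _ _)
  obtain ⟨φ, hφ, hφd⟩ := extraction_forall_of_eventually'
    (P := fun k n => ∀ j ≥ n, sqDist (form hk hE) (u n) (u j) < (δ / 2 / 2 ^ k) ^ 2) fun k => by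
      obtain ⟨N, hN⟩ := hcau ((δ / 2 / 2 ^ k) ^ 2) (by positivity)
      exact ⟨N, fun n hn j hj => hN n hn j (le_trans hn hj)⟩
  choose p hp hpd using fun k => hG.exists_le_add hcomp (u (φ k)) (u (φ (k + 1)))
  obtain ⟨q, hqq, hq⟩ := hG.exists_sum hcomp (p := p) (fun k => by positivity)
    (fun k => (hp k).trans (hφd k _ (hφ.monotone k.le_succ)).le) (hasSum_geometric_two' δ)
  have hmono : ∀ a, Monotone fun k => form hk hE a (u (φ k))
      + form hk hE a (∑ j ∈ Finset.range k, p j) := fun a => monotone_nat_of_le_succ fun k => by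
    rw [Finset.sum_range_succ, map_add]
    linarith [hpd k a]
  have hle' : ∀ n a, form hk hE a (u (φ n)) ≤ form hk hE a (w + q) := fun n a => by
    rw [map_add]
    refine ge_of_tendsto (((hG.tendsto_left hw a).comp hφ.tendsto_atTop).add_const _)
      ((eventually_ge_atTop n).mono fun k hk' => ?_)
    have h1 := hmono a hk'
    have h2 := hG.nonneg a (∑ j ∈ Finset.range n, p j)
    simp only [Function.comp_apply] at h1 ⊢
    linarith [hq a k]
  refine ⟨w + q, fun x hx => ?_, ?_⟩
  · obtain ⟨n, hn⟩ := mem_iUnion.1 hx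
    exact (hu (φ n) x (hA (hφ.id_le n) hn)).trans
      ((pot_le_iff_form_le hk hE hD (u (φ n)) (w + q)).2 (hle' n) x)
  · have h1 : form hk hE w q ≤ s * δ := by
      refine le_of_sq_le_sq ((hG.sq_le w q).trans ?_) (by positivity)
      rw [mul_pow, hss]
      exact mul_le_mul_of_nonneg_left hqq (hG.nonneg _ _)
    simp only [map_add, LinearMap.add_apply]
    rw [hG.symm q w]
    nlinarith

/-- The positive functional given by integration of a continuous compactly supported function. -/
lemma exists_integral_maximizer (hC : Consistent κ) (hA2 : A2 κ) {f : X → ℝ} (hf : Continuous f)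
    (hfc : HasCompactSupport f) : ∃ b : cone hk hE,
      (∀ t : cone hk hE, ∫ x, f x ∂(t : Measure X) ≤ form hk hE b t) ∧
      form hk hE b b = ∫ x, f x ∂(b : Measure X) := by
  have hG := isGram_form hk hE
  have hi : ∀ t : cone hk hE, Integrable f (t : Measure X) := fun t =>
    have := t.2.1.2
    hf.integrable_of_hasCompactSupport hfc
  let ℓ : cone hk hE →ₗ[ℝ≥0] ℝ :=
    { toFun := fun t => ∫ x, f x ∂(t : Measure X)
      map_add' := fun s t => integral_add_measure (hi s) (hi t)
      map_smul' := fun c t => integral_smul_nnreal_measure f c }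
  obtain ⟨a, ha⟩ := exists_approx hk hE hA2 hf hfc
  obtain ⟨p, m, -, hpm⟩ := ha 1 one_pos
  obtain ⟨b, -, h1, h2⟩ := hG.exists_maximizer (strongComplete hk hE hC hA2) ⊤ ℓ
    (C := form hk hE (p + a) (p + a)) (fun t _ => by
      have h1 := (abs_le.1 (hpm t)).1
      have h2 := hG.two_mul_le t (p + a)
      rw [map_add] at h2
      have h3 := hG.nonneg t m
      change 2 * ∫ x, f x ∂(t : Measure X) - _ ≤ _
      linarith)
    fun u b hu => vagueConv_of_strongLim hk hE hC hA2 hu f hf hfc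
  exact ⟨b, fun t => h1 t trivial, h2⟩

lemma exists_small_maximizer (hC : Consistent κ) (hA2 : A2 κ) {K : Set X} (hK : IsCompact K)
    (hnull : EnergyNull κ K) {ε : ℝ} (hε : 0 < ε) :
    ∃ f : X → ℝ, Continuous f ∧ HasCompactSupport f ∧ (∀ x ∈ K, f x = 1) ∧
      ∃ b : cone hk hE, (∀ t : cone hk hE, ∫ x, f x ∂(t : Measure X) ≤ form hk hE b t) ∧
        form hk hE b b < ε := by
  have hG := isGram_form hk hE
  let := TopologicalSpace.pseudoMetrizableSpacePseudoMetric X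
  obtain ⟨f, hfK, -, hfc, hf⟩ := exists_continuous_one_zero_of_isCompact_of_isGδ hK
    hK.isClosed.isGδ isClosed_empty (disjoint_empty K)
  set g : ℕ → X → ℝ := fun n x => f x ^ (n + 1) with hg
  have hgc : ∀ n, Continuous (g n) := fun n => f.continuous.pow _
  have hgs : ∀ n, HasCompactSupport (g n) := fun n => hfc.mono fun x hx h => hx (by simp [hg, h])
  have hgi : ∀ n (t : cone hk hE), Integrable (g n) (t : Measure X) := fun n t =>
    have := t.2.1.2
    (hgc n).integrable_of_hasCompactSupport (hgs n)
  have hanti : ∀ m n, m ≤ n → ∀ t : cone hk hE,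
      ∫ x, g n x ∂(t : Measure X) ≤ ∫ x, g m x ∂(t : Measure X) := fun m n hmn t =>
    integral_mono (hgi n t) (hgi m t) fun x =>
      pow_le_pow_of_le_one (hf x).1 (hf x).2 (by lia)
  choose τ hτ hττ using fun n => exists_integral_maximizer hk hE hC hA2 (hgc n) (hgs n)
  have hdist : ∀ m n, m ≤ n → sqDist (form hk hE) (τ m) (τ n)
      ≤ form hk hE (τ m) (τ m) - form hk hE (τ n) (τ n) := fun m n hmn => by
    have h1 := hτ m (τ n)
    have h2 := hanti m n hmn (τ n)
    rw [← hττ] at h2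
    simp only [sqDist]
    linarith
  have hcau : StrongCauchySeq (form hk hE) τ := by
    have hmon : Antitone fun n => form hk hE (τ n) (τ n) := fun m n hmn => by
      have := hdist m n hmn
      have := hG.sqDist_nonneg (τ m) (τ n)
      linarith
    have hlim := tendsto_atTop_ciInf hmon ⟨0, by rintro _ ⟨n, rfl⟩; exact hG.nonneg _ _⟩
    intro ε hε
    obtain ⟨N, hN⟩ := Metric.cauchySeq_iff.1 hlim.cauchySeq ε hε
    have key : ∀ m ≥ N, ∀ n ≥ m, sqDist (form hk hE) (τ m) (τ n) < ε := fun m hm n hn => by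
      have h1 := hN m hm n (le_trans hm hn)
      rw [Real.dist_eq] at h1
      exact (hdist m n hn).trans_lt (abs_lt.1 h1).2
    refine ⟨N, fun m hm n hn => ?_⟩
    rcases le_total m n with hmn | hmn
    · exact key m hm n hmn
    · rw [hG.sqDist_comm]
      exact key n hn m hmn
  obtain ⟨w, hw, hwv⟩ := exists_strongLim_vague hk hE hC hA2 hcau
  have hlocw := w.2.1.2
  have h1 : ∀ n, form hk hE w w ≤ ∫ x, g n x ∂(w : Measure X) := fun n =>
    le_of_tendsto_of_tendsto (hG.tendsto_self hw) (hwv (g n) (hgc n) (hgs n)) <|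
      (eventually_ge_atTop n).mono fun m hm => (hττ m).trans_le (hanti n m hm (τ m))
  have h2 : Tendsto (fun n => ∫ x, g n x ∂(w : Measure X)) atTop (𝓝 0) := by
    have h3 : Tendsto (fun n => ∫ x, g n x ∂(w : Measure X)) atTop
        (𝓝 (∫ x, K.indicator 1 x ∂(w : Measure X))) := by
      refine tendsto_integral_of_dominated_convergence (g 0)
        (fun n => (hgi n w).aestronglyMeasurable) (hgi 0 w) (fun n => ae_of_all _ fun x => ?_)
        (ae_of_all _ fun x => ?_)
      · rw [Real.norm_of_nonneg (pow_nonneg (hf x).1 _)]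
        exact pow_le_pow_of_le_one (hf x).1 (hf x).2 (by lia)
      · by_cases hx : x ∈ K
        · have h4 : f x = 1 := by rw [hfK] at hx; exact hx
          simp [hg, hx, h4]
        · have h4 : f x ≠ 1 := fun h => hx (by rw [hfK]; exact h)
          simp only [indicator_of_notMem hx]
          exact (tendsto_add_atTop_iff_nat 1).2
            (tendsto_pow_atTop_nhds_zero_of_lt_one (hf x).1 ((hf x).2.lt_of_ne h4))
    rwa [integral_indicator_one hK.measurableSet, measureReal_def,
      hnull K subset_rfl hK w w.2, ENNReal.toReal_zero] at h3
  have h3 : form hk hE w w ≤ 0 := ge_of_tendsto' h2 h1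
  obtain ⟨n, hn⟩ := ((hG.tendsto_self hw).eventually (gt_mem_nhds (h3.trans_lt hε))).exists
  exact ⟨g n, hgc n, hgs n, fun x hx => by
    rw [hfK] at hx
    have h4 : f x = 1 := hx
    simp [hg, h4], τ n, hτ n, hn⟩

end Capacity

section NullSets

variable [SecondCountableTopology X] {κ : X → X → ℝ≥0∞}
  (hk : IsKernel κ) (hE : EnergyPrinciple κ)

/-! ### Borel sets of inner capacity zero have outer capacity zero -/

lemma form_smul_smul (c : ℝ≥0) (a : cone hk hE) :
    form hk hE (c • a) (c • a) = (c : ℝ) ^ 2 * form hk hE a a := by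
  simp only [map_smul, LinearMap.smul_apply, NNReal.smul_def, smul_eq_mul]
  ring

lemma exists_smul_form_lt (a : cone hk hE) {ε : ℝ} (hε : 0 < ε) :
    ∃ s : ℝ≥0, 0 < s ∧ s ≤ 2⁻¹ ∧ form hk hE (s • a) (s • a) < ε := by
  have h0 := (isGram_form hk hE).nonneg a a
  set r := ε / (form hk hE a a + 1) with hr
  have hr0 : 0 < r := by positivity
  refine ⟨min 2⁻¹ r.toNNReal, lt_min (by norm_num) (by simpa using hr0), min_le_left _ _, ?_⟩
  set s : ℝ≥0 := min 2⁻¹ r.toNNReal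
  have h1 : (s : ℝ) ≤ 2⁻¹ := by exact_mod_cast (min_le_left _ _ : s ≤ 2⁻¹)
  have h2 : (s : ℝ) ≤ r := (NNReal.coe_le_coe.2 (min_le_right _ _ : s ≤ r.toNNReal)).trans_eq
    (Real.coe_toNNReal _ hr0.le)
  have h3 : r * (form hk hE a a + 1) = ε := div_mul_cancel₀ _ (by positivity)
  rw [form_smul_smul]
  calc (s : ℝ) ^ 2 * form hk hE a a ≤ r * form hk hE a a :=
        mul_le_mul_of_nonneg_right (by nlinarith [s.2]) h0
    _ < ε := by linarith

lemma capLE_of_isCompact (hC : Consistent κ) (hD : Domination κ) (hA2 : A2 κ) {K : Set X}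
    (hK : IsCompact K) (hnull : EnergyNull κ K) : CapLE hk hE K 0 := by
  have hG := isGram_form hk hE
  intro ε hε
  have hδ : 0 < ε / 35 := by positivity
  obtain ⟨f, hf, hfc, hfK, τ, hτ, hττ⟩ := exists_small_maximizer hk hE hC hA2 hK hnull hδ
  obtain ⟨c, hc⟩ := exists_approx hk hE hA2 hf hfc
  obtain ⟨s, hs0, hs2, hs⟩ := exists_smul_form_lt hk hE c hδ
  obtain ⟨p, m, hpm, hform⟩ := hc s (NNReal.coe_pos.2 hs0)
  obtain ⟨η, hη0, -, hη⟩ := exists_smul_form_lt hk hE (p + m) hδ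
  have hle : ∀ x, pot κ p x ≤ pot κ ((m + (τ + s • c) : cone hk hE) : Measure X) x :=
    (pot_le_iff_form_le hk hE hD _ _).2 fun t => by
      simp only [map_add, map_smul, NNReal.smul_def, smul_eq_mul]
      linarith [(abs_le.1 (hform t)).2, hτ t, hG.symm τ t]
  refine ⟨(2 : ℝ≥0) • (τ + s • c) + η • (p + m), fun x hx => ?_, ?_⟩
  · rw [Submodule.coe_add, pot_add, Submodule.coe_smul, Submodule.coe_smul, pot_smul, pot_smul,
      Submodule.coe_add p m, pot_add]
    by_cases hfin : pot κ p x + pot κ m x = ⊤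
    · simp [hfin, ENNReal.mul_top, hη0.ne']
    · obtain ⟨hp, hm⟩ := ENNReal.add_ne_top.1 hfin
      have h1 := (abs_le.1 (hpm x)).1
      rw [hfK x hx, spot] at h1
      have h2 : (s : ℝ) ≤ 2⁻¹ := by exact_mod_cast hs2
      have h3 : pot κ m x + 2⁻¹ ≤ pot κ p x := by
        rw [← ENNReal.toReal_le_toReal (by simp [hm]) hp, ENNReal.toReal_add hm (by simp)]
        simp only [ENNReal.toReal_inv, ENNReal.toReal_ofNat]
        linarith
      have h4 := h3.trans (hle x)
      rw [Submodule.coe_add, pot_add, ENNReal.add_le_add_iff_left hm] at h4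
      refine le_trans ?_ le_self_add
      calc (1 : ℝ≥0∞) = ((2 : ℝ≥0) : ℝ≥0∞) * 2⁻¹ := by
            rw [ENNReal.coe_ofNat, ENNReal.mul_inv_cancel two_ne_zero ENNReal.ofNat_ne_top]
        _ ≤ _ := by gcongr
  · have h1 := hG.self_add_le ((2 : ℝ≥0) • (τ + s • c)) (η • (p + m))
    have h2 := hG.self_add_le τ (s • c)
    rw [form_smul_smul hk hE 2, NNReal.coe_ofNat] at h1
    linarith

include hk in
lemma isOpen_half_lt_pot (μ : Measure X) : IsOpen {x | 2⁻¹ < pot κ μ x} :=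
  (hk.lowerSemicontinuous_pot (μ := μ)).isOpen_preimage 2⁻¹

lemma one_le_pot_two_smul {a : cone hk hE} {x : X} (hx : 2⁻¹ < pot κ a x) :
    1 ≤ pot κ ((2 : ℝ≥0) • a : cone hk hE) x := by
  rw [Submodule.coe_smul, pot_smul]
  calc (1 : ℝ≥0∞) = ((2 : ℝ≥0) : ℝ≥0∞) * 2⁻¹ := by
        rw [ENNReal.coe_ofNat, ENNReal.mul_inv_cancel two_ne_zero ENNReal.ofNat_ne_top]
    _ ≤ _ := by gcongr

lemma CapLE.exists_isOpen {A : Set X} {t : ℝ} (h : CapLE hk hE A t) {ε : ℝ} (hε : 0 < ε) :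
    ∃ D, IsOpen D ∧ A ⊆ D ∧ ∃ a : cone hk hE, (∀ x ∈ D, 1 ≤ pot κ a x) ∧
      form hk hE a a < 4 * t + ε := by
  obtain ⟨a, ha, hlt⟩ := h (ε / 4) (by positivity)
  refine ⟨_, isOpen_half_lt_pot hk a, fun x hx => ?_, (2 : ℝ≥0) • a,
    fun x => one_le_pot_two_smul hk hE, ?_⟩
  · exact (ENNReal.inv_lt_one.2 ENNReal.one_lt_two).trans_le (ha x hx)
  · rw [form_smul_smul, NNReal.coe_ofNat]
    linarith

lemma innerCap_le_of_one_le_pot {A : Set X} {a : cone hk hE} (h : ∀ x ∈ A, 1 ≤ pot κ a x) :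
    innerCap κ A ≤ ENNReal.ofReal (form hk hE a a) := by
  have hG := isGram_form hk hE
  rw [innerCap, ENNReal.inv_le_iff_inv_le]
  refine le_iInf₂ fun μ hμ => ?_
  obtain ⟨⟨hμE, hconc⟩, h1⟩ := hμ
  let m : cone hk hE := ⟨μ, hμE⟩
  have h2 : 1 ≤ energy κ m a := by
    rw [← h1, ← lintegral_one]
    refine lintegral_mono_ae ?_
    filter_upwards [mem_ae_iff.2 hconc.measure_compl] with x hx using h x hx
  rw [← ofReal_form, ENNReal.one_le_ofReal] at h2
  have h3 : energy κ μ μ = ENNReal.ofReal (form hk hE m m) := (ofReal_form hk hE m m).symm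
  rw [ENNReal.inv_le_iff_le_mul (fun h => absurd h hμE.2.ne) (by simp), h3,
    ← ENNReal.ofReal_mul (hG.nonneg _ _),
    ENNReal.one_le_ofReal]
  have h4 := hG.sq_le m a
  nlinarith

lemma CapLE.outerCap_eq_zero {A : Set X} (h : CapLE hk hE A 0) : outerCap κ A = 0 := by
  refine le_antisymm (ENNReal.le_of_forall_pos_le_add fun ε hε _ => ?_) zero_le
  obtain ⟨D, hD, hAD, a, ha, hlt⟩ := h.exists_isOpen hk hE (NNReal.coe_pos.2 hε)
  rw [zero_add]
  refine (iInf₂_le D ⟨hD, hAD⟩).trans ((innerCap_le_of_one_le_pot hk hE ha).trans ?_)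
  exact ENNReal.ofReal_le_of_le_toReal (by simpa using hlt.le)

lemma capLE_range_of_compacts (hC : Consistent κ) (hD : Domination κ) (hA2 : A2 κ)
    {f : (ℕ → ℕ) → X} (hf : Continuous f) (h : ∀ K ⊆ range f, IsCompact K → CapLE hk hE K 0) :
    CapLE hk hE (range f) 0 := by
  intro ε hε
  by_contra hcon
  set t := ε / 2 with ht
  have h0 : ¬ CapLE hk hE (f '' univ) t := fun h => hcon <| by
    obtain ⟨a, ha, hlt⟩ := h t (by positivity)
    exact ⟨a, fun x hx => ha x (by rwa [image_univ]), by linarith⟩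
  have hstep : ∀ (k : ℕ) (S : {S : Set (ℕ → ℕ) // ¬ CapLE hk hE (f '' S) t}),
      ∃ v, ¬ CapLE hk hE (f '' (S.1 ∩ {x | x k ≤ v})) t := fun k S => by
    by_contra! hall
    refine S.2 ((capLE_iUnion hk hE hC hD hA2 (fun v w hvw => ?_) hall).mono hk hE ?_)
    · exact image_mono (inter_subset_inter_right _ fun x hx => le_trans hx hvw)
    · rintro _ ⟨x, hx, rfl⟩
      exact mem_iUnion.2 ⟨x k, x, ⟨hx, le_refl (x k)⟩, rfl⟩
  choose v hv using hstep
  let T : ℕ → {S : Set (ℕ → ℕ) // ¬ CapLE hk hE (f '' S) t} := fun k =>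
    Nat.rec ⟨univ, h0⟩ (fun k S => ⟨_, hv k S⟩) k
  set n : ℕ → ℕ := fun k => v k (T k) with hn
  have hT : ∀ k, ∀ x ∈ (T k).1, ∀ i < k, x i ≤ n i := fun k => by
    induction k with
    | zero => simp
    | succ k ih =>
      rintro x ⟨hx, hxk⟩ i hi
      rcases (Nat.lt_succ_iff_lt_or_eq.1 hi) with hi | rfl
      · exact ih x hx i hi
      · exact hxk
  have hP : IsCompact (univ.pi fun i => Iic (n i)) :=
    isCompact_univ_pi fun i => (finite_Iic (n i)).isCompact
  obtain ⟨D, hDo, hPD, a, ha, hlt⟩ :=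
    (h _ (image_subset_range _ _) (hP.image hf)).exists_isOpen hk hE
      (show 0 < t by positivity)
  rw [mul_zero, zero_add] at hlt
  have hnot : ∀ k, ∃ x ∈ (T k).1, f x ∉ D := fun k => by
    by_contra! hall
    refine (T k).2 fun δ hδ => ⟨a, ?_, by linarith⟩
    rintro _ ⟨x, hx, rfl⟩
    exact ha _ (hall x hx)
  choose x hxT hxD using hnot
  obtain ⟨y, hy, φ, hφ, hlim⟩ := hP.tendsto_subseq (x := fun k i => min (x k i) (n i))
    fun k i _ => min_le_right (x k i) (n i)
  have hlim' : Tendsto (fun k => x (φ k)) atTop (𝓝 y) := by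
    rw [tendsto_pi_nhds] at hlim ⊢
    refine fun i => (hlim i).congr' ((eventually_gt_atTop i).mono fun k hk' => ?_)
    exact min_eq_left (hT _ _ (hxT (φ k)) i (hk'.trans_le (hφ.id_le k)))
  obtain ⟨k, hk'⟩ := (((hf.tendsto y).comp hlim').eventually
    (hDo.mem_nhds (hPD ⟨y, hy, rfl⟩))).exists
  exact hxD _ hk'

lemma _root_.MeasurableSet.analyticSet_of_locallyCompact {B : Set X} (hB : MeasurableSet B) :
    AnalyticSet B := by
  have h : B = ⋃ n, ((↑) : compactCovering X n → X) '' ((↑) ⁻¹' B) := by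
    simp only [Subtype.image_preimage_coe, ← iUnion_inter, iUnion_compactCovering, univ_inter]
  rw [h]
  refine AnalyticSet.iUnion fun n => ?_
  have := isCompact_iff_compactSpace.1 (isCompact_compactCovering X n)
  let := TopologicalSpace.metrizableSpaceMetric (compactCovering X n)
  exact (measurable_subtype_coe hB).analyticSet.image_of_continuous continuous_subtype_val

include hk hE in
lemma EnergyNull.outerCap_eq_zero (hC : Consistent κ) (hD : Domination κ) (hA2 : A2 κ) {B : Set X}
    (hB : MeasurableSet B) (h : EnergyNull κ B) : outerCap κ B = 0 := by
  have hana := hB.analyticSet_of_locallyCompact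
  rw [AnalyticSet] at hana
  have hcap : ∀ K ⊆ B, IsCompact K → CapLE hk hE K 0 := fun K hKB hK =>
    capLE_of_isCompact hk hE hC hD hA2 hK (h.mono hKB)
  rcases hana with rfl | ⟨f, hf, rfl⟩
  · exact (hcap ∅ subset_rfl isCompact_empty).outerCap_eq_zero hk hE
  · exact (capLE_range_of_compacts hk hE hC hD hA2 hf hcap).outerCap_eq_zero hk hE

include hk hE in
lemma IsInnerBal.isOuterBal (hC : Consistent κ) (hD : Domination κ) (hA2 : A2 κ) {B : Set X}
    (hB : MeasurableSet B) {μ b : Measure X} (hμ : μ ∈ Eplus κ) (h : IsInnerBal κ B μ b) :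
    IsOuterBal κ B μ b := by
  have := sigmaFinite_of_mem hμ
  have := sigmaFinite_of_mem h.1.1
  refine ⟨⟨h.1.1, ?_⟩, fun ν hν => h.2 ν (OuterLam_subset_InnerLam B μ hν)⟩
  refine EnergyNull.outerCap_eq_zero hk hE hC hD hA2 (hB.inter
    (measurableSet_le hk.measurable_pot hk.measurable_pot).compl) ?_
  exact (innerCap_eq_zero_iff hk hE).1 h.1.2

end NullSets

/-- There is a σ-compact `A₀ ⊆ A`, independent of `μ`, such that `μ^A = μ^Q = μ^{A₀}`
for all `A₀ ⊆ Q ⊆ A`, and `μ^A = μ^{*B} = μ^{*A₀}` for all Borel `A₀ ⊆ B ⊆ A`. -/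
theorem statement5 [SecondCountableTopology X] (κ : X → X → ℝ≥0∞) (hker : IsKernel κ)
    (hE : EnergyPrinciple κ) (hC : Consistent κ) (hD : Domination κ) (hA2 : A2 κ) :
    ∀ A : Set X, ∃ A₀ : Set X, A₀ ⊆ A ∧ IsSigmaCompact A₀ ∧
      (∀ Q : Set X, A₀ ⊆ Q → Q ⊆ A → ∀ μ ∈ Eplus κ, ∃ b : Measure X,
        IsInnerBal κ A μ b ∧ IsInnerBal κ Q μ b ∧ IsInnerBal κ A₀ μ b) ∧
      (∀ B : Set X, MeasurableSet B → A₀ ⊆ B → B ⊆ A → ∀ μ ∈ Eplus κ, ∃ b : Measure X,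
        IsInnerBal κ A μ b ∧ IsOuterBal κ B μ b ∧ IsOuterBal κ A₀ μ b) := by
  intro A
  obtain ⟨A₀, hA₀, hσ, h⟩ := exists_sigmaCompact_isProj hker hE hC hD hA2 A
  have hbal : ∀ a : cone hker hE, ∃ b, ∀ Q, A₀ ⊆ Q → Q ⊆ A → IsInnerBal κ Q a b := fun a => by
    obtain ⟨b, hb⟩ := h a
    exact ⟨(b : Measure X), fun Q h1 h2 => (hb Q h1 h2).isInnerBal hC hA2 hD⟩
  refine ⟨A₀, hA₀, hσ, fun Q h1 h2 μ hμ => ?_, fun B hB h1 h2 μ hμ => ?_⟩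
  · obtain ⟨b, hb⟩ := hbal ⟨μ, hμ⟩
    exact ⟨b, hb A hA₀ subset_rfl, hb Q h1 h2, hb A₀ subset_rfl hA₀⟩
  · obtain ⟨b, hb⟩ := hbal ⟨μ, hμ⟩
    have hm : MeasurableSet A₀ := by
      obtain ⟨K, hK, rfl⟩ := hσ
      exact MeasurableSet.iUnion fun n => (hK n).measurableSet
    exact ⟨b, hb A hA₀ subset_rfl, (hb B h1 h2).isOuterBal hker hE hC hD hA2 hB hμ,
      (hb A₀ subset_rfl hA₀).isOuterBal hker hE hC hD hA2 hm hμ⟩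

end Balayage
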